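/- arXiv:0903.0261 — 4 statements merged into one kernel-verified Lean document; each statement's English description precedes it below -/
import Mathlib

section
/- Let p ≥ 5 be a prime and a, b integers with b ≥ 0, p | a, and p | b. Then binom(a,b) ≡ binom(a/p, b/p) (mod p^r) where r = v_p(a) + v_p(b) + v_p(a-b) + v_p(binom(a/p, b/p)) - 2, assuming a ≠ b and binom(a/p,b/p) ≠ 0 so that r is well-defined. -/
open Finset in
theorem jc_prod_add {ι : Type*} [DecidableEq ι] (s : Finset ι) (d : ι → ℤ) (y : ℤ) :
    ∃ k, ∏ i ∈ s, (y + d i) = ∏ i ∈ s, d i + y * ∑ i ∈ s, ∏ j ∈ s.erase i, d j + y ^ 2 * k := by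
  induction s using Finset.induction_on with
  | empty => exact ⟨0, by simp⟩
  | insert a s ha ih =>
    obtain ⟨k, hk⟩ := ih
    have h : ∑ i ∈ s, ∏ j ∈ (insert a s).erase i, d j = d a * ∑ i ∈ s, ∏ j ∈ s.erase i, d j := by
      rw [mul_sum]
      refine sum_congr rfl fun i hi => ?_
      have hne : a ≠ i := fun h => ha (h ▸ hi)
      rw [erase_insert_of_ne hne, prod_insert (by simp [ha])]
    refine ⟨∑ i ∈ s, ∏ j ∈ s.erase i, d j + (y + d a) * k, ?_⟩
    rw [prod_insert ha, prod_insert ha, sum_insert ha, erase_insert ha, h, hk]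
    ring

theorem jc_sum_inv (n : ℕ) [NeZero n] (h2 : IsUnit (2 : ZMod n)) (h3 : IsUnit (3 : ZMod n)) :
    ∑ x : ZMod n, (Ring.inverse x) ^ 2 = 0 := by
  have h : ∑ x : ZMod n, (Ring.inverse x) ^ 2 = ∑ x : ZMod n, (Ring.inverse (2 * x)) ^ 2 := by
    refine (Fintype.sum_equiv (Units.mulLeft h2.unit) _ _ fun x => ?_).symm
    simp
  have h4 : ∀ x : ZMod n, 4 * (Ring.inverse (2 * x)) ^ 2 = (Ring.inverse x) ^ 2 := by
    intro x
    have h5 : Ring.inverse (2 : ZMod n) * 2 = 1 := Ring.inverse_mul_cancel _ h2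
    rw [Ring.mul_inverse_rev]
    linear_combination (Ring.inverse x) ^ 2 * (Ring.inverse (2 : ZMod n) * 2 + 1) * h5
  have h6 : 4 * ∑ x : ZMod n, (Ring.inverse x) ^ 2 = ∑ x : ZMod n, (Ring.inverse x) ^ 2 := by
    conv_lhs => rw [h]
    rw [Finset.mul_sum]
    exact Finset.sum_congr rfl fun x _ => h4 x
  refine h3.mul_left_cancel ?_
  linear_combination h6

theorem jc_sum_range (n : ℕ) [NeZero n] (m : ℕ) (f : ZMod n → ZMod n) :
    ∑ j ∈ Finset.range (n * m), f (j : ZMod n) = m * ∑ x : ZMod n, f x := by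
  induction m with
  | zero => simp
  | succ m ih =>
    have h : ∑ j ∈ Finset.range n, f (j : ZMod n) = ∑ x : ZMod n, f x := by
      refine Finset.sum_bij (fun j _ => (j : ZMod n)) (by simp) ?_ ?_ (by simp)
      · intro a ha b hb hab
        rw [ZMod.natCast_eq_natCast_iff] at hab
        exact Nat.ModEq.eq_of_lt_of_lt hab (by simpa using ha) (by simpa using hb)
      · intro x _
        exact ⟨x.val, by simpa using ZMod.val_lt x, by simp⟩
    rw [Nat.mul_succ, Finset.sum_range_add, ih]
    simp only [Nat.cast_add, Nat.cast_mul, CharP.cast_eq_zero, zero_mul, zero_add, h]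
    push_cast
    ring

/-- integers below `n` prime to `p` -/
def jcS (p n : ℕ) : Finset ℕ := (Finset.range n).filter (fun i => ¬ p ∣ i)

/-- their product -/
def jcU (p n : ℕ) : ℤ := ∏ i ∈ jcS p n, (i : ℤ)

theorem jc_isUnit {p : ℕ} (hp : p.Prime) (k j : ℕ) (h : ¬ p ∣ j) :
    IsUnit (j : ZMod (p ^ k)) := by
  rw [ZMod.isUnit_iff_coprime]
  exact (((Nat.Prime.coprime_iff_not_dvd hp).2 h).symm).pow_right k

theorem jc_E {p : ℕ} (hp : p.Prime) (hp5 : 5 ≤ p) (b β : ℕ) (hβ : 1 ≤ β) (hb : p ^ β ∣ b) :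
    ((p : ℤ) ^ β) ∣ ∑ i ∈ jcS p b, ∏ j ∈ (jcS p b).erase i, ((j : ℤ) * ((b : ℤ) - j)) := by
  have : NeZero (p ^ β) := ⟨pow_ne_zero _ hp.ne_zero⟩
  have h2 : IsUnit (2 : ZMod (p ^ β)) := by
    exact_mod_cast jc_isUnit hp β 2 (fun h => by have := Nat.le_of_dvd (by norm_num) h; omega)
  have h3 : IsUnit (3 : ZMod (p ^ β)) := by
    exact_mod_cast jc_isUnit hp β 3 (fun h => by have := Nat.le_of_dvd (by norm_num) h; omega)
  have hb0 : (b : ZMod (p ^ β)) = 0 := (ZMod.natCast_eq_zero_iff _ _).2 hb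
  have key : ∑ i ∈ jcS p b, (Ring.inverse (i : ZMod (p ^ β))) ^ 2 = 0 := by
    have h1 : ∑ i ∈ jcS p b, (Ring.inverse (i : ZMod (p ^ β))) ^ 2
        = ∑ i ∈ Finset.range b, (Ring.inverse (i : ZMod (p ^ β))) ^ 2 := by
      refine Finset.sum_subset (Finset.filter_subset _ _) ?_
      intro x hx hx'
      have hpx : p ∣ x := by
        by_contra h
        exact hx' (Finset.mem_filter.2 ⟨hx, h⟩)
      rw [Ring.inverse_non_unit, zero_pow two_ne_zero]
      rw [ZMod.isUnit_iff_coprime]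
      intro hc
      have := Nat.Coprime.coprime_dvd_right (dvd_pow_self p (by omega : β ≠ 0)) hc
      have := Nat.Coprime.eq_one_of_dvd this.symm hpx
      omega
    obtain ⟨m, rfl⟩ := hb
    rw [h1, jc_sum_range (p ^ β) m (fun x => (Ring.inverse x) ^ 2), jc_sum_inv _ h2 h3, mul_zero]
  have : (((p ^ β : ℕ) : ℤ)) ∣ ∑ i ∈ jcS p b, ∏ j ∈ (jcS p b).erase i, ((j : ℤ) * ((b : ℤ) - j)) := by
    rw [← ZMod.intCast_zmod_eq_zero_iff_dvd]
    push_cast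
    simp only [hb0, zero_sub]
    have : ∀ i ∈ jcS p b, ∏ j ∈ (jcS p b).erase i, ((j : ZMod (p ^ β)) * (-j))
        = -(∏ j ∈ jcS p b, ((j : ZMod (p ^ β)) * (-j))) * (Ring.inverse (i : ZMod (p ^ β))) ^ 2 := by
      intro i hi
      have hu := jc_isUnit hp β i (Finset.mem_filter.1 hi).2
      rw [← Finset.mul_prod_erase _ _ hi]
      have := Ring.mul_inverse_cancel _ hu
      linear_combination (-(∏ j ∈ (jcS p b).erase i, ((j : ZMod (p ^ β)) * (-j))) *
        ((i : ZMod (p ^ β)) * Ring.inverse (i : ZMod (p ^ β)) + 1)) * this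
    rw [Finset.sum_congr rfl this, ← Finset.mul_sum, key, mul_zero]
  exact_mod_cast this

theorem jcU_not_dvd {p : ℕ} (hp : p.Prime) (n : ℕ) : ¬ (p : ℤ) ∣ jcU p n := by
  intro h
  obtain ⟨i, hi, h⟩ := (Prime.dvd_finsetProd_iff (Nat.prime_iff_prime_int.1 hp) _).1 h
  exact (Finset.mem_filter.1 hi).2 (by exact_mod_cast h)

theorem jcU_add (p b c : ℕ) (hc : p ∣ c) :
    jcU p (c + b) = jcU p c * ∏ j ∈ jcS p b, ((c : ℤ) + j) := by
  simp only [jcU, jcS, Finset.prod_filter]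
  rw [Finset.prod_range_add]
  congr 1
  refine Finset.prod_congr rfl fun i _ => ?_
  simp [(Nat.dvd_add_right hc)]

theorem jc_refl (p b : ℕ) (hb : p ∣ b) (f : ℤ → ℤ) :
    ∏ j ∈ jcS p b, f ((b : ℤ) - j) = ∏ j ∈ jcS p b, f j := by
  have hm : ∀ a ∈ jcS p b, b - a ∈ jcS p b := by
    intro a ha
    simp only [jcS, Finset.mem_filter, Finset.mem_range] at ha ⊢
    have h0 : a ≠ 0 := by rintro rfl; simp at ha
    refine ⟨by omega, fun h => ha.2 ?_⟩
    have := Nat.dvd_sub hb h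
    rwa [Nat.sub_sub_self ha.1.le] at this
  have hl : ∀ a ∈ jcS p b, a < b := by
    intro a ha
    simpa using (Finset.mem_filter.1 ha).1
  refine Finset.prod_bij' (fun j _ => b - j) (fun j _ => b - j) hm hm ?_ ?_ ?_
  · intro a ha; have := hl a ha; omega
  · intro a ha; have := hl a ha; omega
  · intro a ha; have := hl a ha; rw [Nat.cast_sub this.le]

theorem jc_core {p : ℕ} (hp : p.Prime) (hp5 : 5 ≤ p) (b c α β γ : ℕ) (hβ : 1 ≤ β)
    (hαβ : β ≤ α) (hγβ : β ≤ γ) (ha : p ^ α ∣ c + b) (hb : p ^ β ∣ b) (hc : p ^ γ ∣ c) :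
    (p : ℤ) ^ (α + β + γ) ∣ jcU p (c + b) - jcU p c * jcU p b := by
  have hpb : p ∣ b := (dvd_pow_self p (by omega)).trans hb
  have hpc : p ∣ c := (dvd_pow_self p (by omega)).trans hc
  rw [jcU_add p b c hpc, ← mul_sub]
  refine Dvd.dvd.mul_left ?_ _
  set P := ∏ j ∈ jcS p b, ((c : ℤ) + j) with hP
  have hsq : P ^ 2 = ∏ j ∈ jcS p b, (((c : ℤ) * (c + b)) + (j : ℤ) * ((b : ℤ) - j)) := by
    rw [sq]
    nth_rewrite 2 [hP]
    rw [← jc_refl p b hpb (fun x => (c : ℤ) + x), hP, ← Finset.prod_mul_distrib]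
    exact Finset.prod_congr rfl fun i _ => by ring
  have hsq0 : jcU p b ^ 2 = ∏ j ∈ jcS p b, ((j : ℤ) * ((b : ℤ) - j)) := by
    rw [Finset.prod_mul_distrib, jc_refl p b hpb (fun x => x), sq]; rfl
  obtain ⟨k, hk⟩ := jc_prod_add (jcS p b) (fun j => (j : ℤ) * ((b : ℤ) - j)) ((c : ℤ) * (c + b))
  obtain ⟨e, he⟩ := jc_E hp hp5 b β hβ hb
  rw [← hsq, ← hsq0, he] at hk
  have ha' : (p : ℤ) ^ α ∣ (c : ℤ) + b := by exact_mod_cast ha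
  have hc' : (p : ℤ) ^ γ ∣ (c : ℤ) := by exact_mod_cast hc
  have hy : (p : ℤ) ^ (γ + α) ∣ (c : ℤ) * (c + b) := by
    rw [pow_add]; exact mul_dvd_mul hc' ha'
  have hd : (p : ℤ) ^ (α + β + γ) ∣ (P + jcU p b) * (P - jcU p b) := by
    have : (P + jcU p b) * (P - jcU p b) = (c : ℤ) * (c + b) * ((p : ℤ) ^ β * e)
      + (c : ℤ) * (c + b) * ((c : ℤ) * (c + b)) * k := by linear_combination hk
    rw [this]
    refine dvd_add ?_ ?_
    · rw [← mul_assoc, show α + β + γ = γ + α + β by ring, pow_add]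
      exact (mul_dvd_mul_right hy _).mul_right _
    · refine Dvd.dvd.mul_right ?_ _
      refine (pow_dvd_pow _ (by omega : α + β + γ ≤ (γ + α) + (γ + α))).trans ?_
      rw [pow_add]; exact mul_dvd_mul hy hy
  have hpI := Nat.prime_iff_prime_int.1 hp
  have hPU : (p : ℤ) ∣ P - jcU p b := by
    rw [← Int.modEq_iff_dvd, jcU, hP]
    refine Int.ModEq.prod fun i _ => ?_
    rw [Int.modEq_iff_dvd]
    simpa using (by exact_mod_cast hpc : (p : ℤ) ∣ c)
  have hcop : ¬ (p : ℤ) ∣ P + jcU p b := by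
    intro h
    have h2 : (p : ℤ) ∣ 2 * jcU p b := by
      have := dvd_sub h hPU
      rwa [show P + jcU p b - (P - jcU p b) = 2 * jcU p b by ring] at this
    rcases hpI.dvd_or_dvd h2 with h | h
    · have := Int.le_of_dvd (by norm_num) h; omega
    · exact jcU_not_dvd hp b h
  refine IsCoprime.dvd_of_dvd_mul_left ?_ hd
  exact ((Prime.coprime_iff_not_dvd hpI).2 hcop).pow_left

theorem jc_core' {p : ℕ} (hp : p.Prime) (hp5 : 5 ≤ p) (b c : ℕ) (hb : p ∣ b) (hc : p ∣ c)
    (hb0 : b ≠ 0) (hc0 : c ≠ 0) :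
    (p : ℤ) ^ (padicValNat p (c + b) + padicValNat p b + padicValNat p c) ∣
      jcU p (c + b) - jcU p c * jcU p b := by
  have : Fact p.Prime := ⟨hp⟩
  have hs : c + b ≠ 0 := by omega
  have h1 := one_le_padicValNat_of_dvd hb0 hb
  have h2 := one_le_padicValNat_of_dvd hc0 hc
  have hB : p ^ padicValNat p b ∣ b := pow_padicValNat_dvd
  have hC : p ^ padicValNat p c ∣ c := pow_padicValNat_dvd
  have hA : p ^ padicValNat p (c + b) ∣ c + b := pow_padicValNat_dvd
  rcases le_total (padicValNat p b) (padicValNat p c) with h | h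
  · exact jc_core hp hp5 b c _ _ _ h1 ((padicValNat_dvd_iff_le hs).1
      (dvd_add ((pow_dvd_pow p h).trans hC) hB)) h hA hB hC
  · have := jc_core hp hp5 c b _ _ _ h2 ((padicValNat_dvd_iff_le (by omega : b + c ≠ 0)).1
      (dvd_add ((pow_dvd_pow p h).trans hB) hC)) h pow_padicValNat_dvd hC hB
    rw [add_comm b c, mul_comm (jcU p b)] at this
    rwa [show padicValNat p (c + b) + padicValNat p b + padicValNat p c
      = padicValNat p (c + b) + padicValNat p c + padicValNat p b by ring]

theorem jc_Icc (n : ℕ) : ∏ x ∈ Finset.Icc 1 n, x = n.factorial := by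
  rw [← Finset.prod_Ico_id_eq_factorial]
  refine Finset.prod_congr ?_ fun _ _ => rfl
  ext i
  simp only [Finset.mem_Icc, Finset.mem_Ico]
  omega

theorem jc_fact {p : ℕ} (hp : p.Prime) (N : ℕ) :
    ((p * N).factorial : ℤ) = jcU p (p * N) * (p : ℤ) ^ N * N.factorial := by
  have hp0 := hp.pos
  have hU : jcU p (p * N) = ∏ i ∈ (Finset.Icc 1 (p * N)).filter (fun i => ¬ p ∣ i), (i : ℤ) := by
    unfold jcU
    refine Finset.prod_congr ?_ fun _ _ => rfl
    ext i
    simp only [jcS, Finset.mem_filter, Finset.mem_range, Finset.mem_Icc]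
    constructor
    · rintro ⟨h1, h2⟩
      refine ⟨⟨Nat.pos_of_ne_zero (by rintro rfl; simp at h2), h1.le⟩, h2⟩
    · rintro ⟨⟨h1, h3⟩, h2⟩
      refine ⟨lt_of_le_of_ne h3 (by rintro rfl; simp at h2), h2⟩
  have hV : ∏ i ∈ (Finset.Icc 1 (p * N)).filter (fun i => p ∣ i), (i : ℤ)
      = (p : ℤ) ^ N * N.factorial := by
    have : (Finset.Icc 1 (p * N)).filter (fun i => p ∣ i)
        = (Finset.Icc 1 N).image (fun i => p * i) := by
      ext i
      simp only [Finset.mem_filter, Finset.mem_image, Finset.mem_Icc]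
      constructor
      · rintro ⟨⟨h1, h3⟩, m, rfl⟩
        exact ⟨m, ⟨Nat.pos_of_ne_zero (by rintro rfl; simp at h1),
          Nat.le_of_mul_le_mul_left h3 hp0⟩, rfl⟩
      · rintro ⟨m, ⟨h1, h3⟩, rfl⟩
        exact ⟨⟨Nat.mul_pos hp0 h1, Nat.mul_le_mul_left p h3⟩, dvd_mul_right _ _⟩
    rw [this, Finset.prod_image (fun x _ y _ h => Nat.eq_of_mul_eq_mul_left hp0 h)]
    push_cast
    rw [Finset.prod_mul_distrib, Finset.prod_const, Nat.card_Icc, Nat.add_sub_cancel,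
      ← jc_Icc]
    push_cast
    rfl
  rw [hU, mul_assoc, ← hV, mul_comm (∏ i ∈ _, _), Finset.prod_filter_mul_prod_filter_not,
    ← jc_Icc]
  push_cast
  rfl

theorem jc_choose {p : ℕ} (hp : p.Prime) (B C : ℕ) :
    ((p * C + p * B).choose (p * B) : ℤ) * (jcU p (p * C) * jcU p (p * B))
      = jcU p (p * C + p * B) * ((C + B).choose B : ℤ) := by
  have h1 : ((p * C + p * B).choose (p * B) : ℤ) * (p * C).factorial * (p * B).factorial
      = (p * C + p * B).factorial := by
    have := Nat.choose_mul_factorial_mul_factorial (Nat.le_add_left (p * B) (p * C))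
    rw [Nat.add_sub_cancel, mul_right_comm] at this
    exact_mod_cast this
  have h2 : ((C + B).choose B : ℤ) * C.factorial * B.factorial = (C + B).factorial := by
    have := Nat.choose_mul_factorial_mul_factorial (Nat.le_add_left B C)
    rw [Nat.add_sub_cancel, mul_right_comm] at this
    exact_mod_cast this
  have h3 := jc_fact hp (C + B)
  rw [mul_add, ← h1, ← h2, jc_fact hp C, jc_fact hp B, pow_add] at h3
  have hne : (p : ℤ) ^ C * p ^ B * C.factorial * B.factorial ≠ 0 := by
    have : (p : ℤ) ≠ 0 := by exact_mod_cast hp.ne_zero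
    have := Nat.factorial_ne_zero C
    have := Nat.factorial_ne_zero B
    positivity
  refine mul_right_cancel₀ hne ?_
  linear_combination h3

theorem jc_final {p : ℕ} (hp : p.Prime) (X X' V V1 : ℤ) (q : ℕ) (hV : ¬ (p : ℤ) ∣ V)
    (h : X * V = V1 * X') (hq : (p : ℤ) ^ q ∣ V1 - V) :
    X ≡ X' [ZMOD (p : ℤ) ^ (q + padicValInt p X')] := by
  have : Fact p.Prime := ⟨hp⟩
  symm
  rw [Int.modEq_iff_dvd]
  have hd : (p : ℤ) ^ (q + padicValInt p X') ∣ V * (X - X') := by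
    rw [show V * (X - X') = (V1 - V) * X' by linear_combination h, pow_add]
    exact mul_dvd_mul hq (padicValInt_dvd X')
  refine IsCoprime.dvd_of_dvd_mul_left ?_ hd
  exact ((Prime.coprime_iff_not_dvd (Nat.prime_iff_prime_int.1 hp)).2 hV).pow_left

theorem jc_pred (n b : ℕ) (hn : 1 ≤ n) : ((n + b : ℕ) : ℤ) * ((n + b - 1).choose b : ℤ)
    = n * ((n + b).choose b : ℤ) := by
  obtain ⟨m, rfl⟩ : ∃ m, n = m + 1 := ⟨n - 1, by omega⟩
  have := Nat.add_one_mul_choose_eq (m + b) m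
  have e : m + 1 + b - 1 = m + b := by omega
  rw [e]
  have e1 : (m + b).choose b = (m + b).choose m := by
    rw [Nat.choose_symm_add]
  have e2 : (m + 1 + b).choose b = (m + b + 1).choose (m + 1) := by
    rw [← Nat.choose_symm_add, show m + 1 + b = m + b + 1 by ring]
  rw [e1, e2]
  have e3 : m + 1 + b = m + b + 1 := by ring
  rw [e3]
  have : (m + b + 1) * (m + b).choose m = (m + 1) * (m + b + 1).choose (m + 1) := by
    rw [this]; ring
  exact_mod_cast this


/-- Generalized binomial coefficient `binom(a, b) = a(a-1)⋯(a-b+1)/b!` for `a : ℤ`,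
`b : ℕ`; for negative `a` it is given by `binom(a,b) = (-1)^b binom(b-1-a, b)`. -/
def zbinom (a : ℤ) (b : ℕ) : ℤ :=
  if 0 ≤ a then (a.toNat.choose b : ℤ)
  else (-1) ^ b * (((b : ℤ) - 1 - a).toNat.choose b : ℤ)

/-- (Jacobsthal's congruence, Lemma `gessel` for `p ≥ 5`.)  For a prime `p ≥ 5` and
integers `a`, `b ≥ 0` divisible by `p` (with `a ≠ 0`, `b ≠ 0`, `a ≠ b` and
`binom(a/p, b/p) ≠ 0` so that the valuations are defined),
`binom(a,b) ≡ binom(a/p, b/p) (mod p^r)` where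
`r = v_p(a) + v_p(b) + v_p(a-b) + v_p(binom(a/p, b/p)) - 2`. -/
theorem jacobsthal_congruence (p : ℕ) (hp : p.Prime) (hp5 : 5 ≤ p) (a : ℤ) (b : ℕ)
    (ha : a ≠ 0) (hb : b ≠ 0) (hpa : (p : ℤ) ∣ a) (hpb : p ∣ b)
    (hab : a ≠ (b : ℤ)) (hnz : zbinom (a / p) (b / p) ≠ 0) :
    zbinom a b ≡ zbinom (a / p) (b / p)
      [ZMOD (p : ℤ) ^ (padicValInt p a + padicValNat p b + padicValInt p (a - b)
        + padicValInt p (zbinom (a / p) (b / p)) - 2)] := by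
  have : Fact p.Prime := ⟨hp⟩
  have hp0 := hp.pos
  have hpz : (p : ℤ) ≠ 0 := by exact_mod_cast hp.ne_zero
  obtain ⟨A, rfl⟩ := hpa
  obtain ⟨B, rfl⟩ := hpb
  rw [Int.mul_ediv_cancel_left _ hpz, Nat.mul_div_cancel_left _ hp0] at *
  have hB0 : B ≠ 0 := by rintro rfl; simp at hb
  have hA0 : A ≠ 0 := by rintro rfl; simp at ha
  have hUV : ∀ m n, ¬ (p : ℤ) ∣ jcU p m * jcU p n := fun m n h =>
    ((Nat.prime_iff_prime_int.1 hp).dvd_or_dvd h).elim (jcU_not_dvd hp m) (jcU_not_dvd hp n)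
  refine Int.ModEq.of_dvd (pow_dvd_pow _ (Nat.sub_le _ 2)) ?_
  rcases lt_or_ge A 0 with hneg | hpos
  · obtain ⟨C, rfl⟩ : ∃ C : ℕ, A = -(C : ℤ) := ⟨A.natAbs, by omega⟩
    have hC : 1 ≤ C := by omega
    have hC0 : C ≠ 0 := by omega
    have hpC : 1 ≤ p * C := Nat.mul_pos hp0 hC
    have z1 : zbinom (p * -(C : ℤ)) (p * B)
        = (-1) ^ B * ((p * C + p * B - 1).choose (p * B) : ℤ) := by
      have hn : ¬ (0 ≤ (p : ℤ) * -(C : ℤ)) := by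
        have : (1 : ℤ) ≤ p * C := by exact_mod_cast hpC
        linarith [mul_neg (p : ℤ) (C : ℤ)]
      rw [zbinom, if_neg hn, pow_mul, (hp.odd_of_ne_two (by omega)).neg_one_pow]
      congr 3
      have : ((p * B : ℕ) : ℤ) - 1 - p * -(C : ℤ) = ((p * C + p * B - 1 : ℕ) : ℤ) := by
        rw [Nat.cast_sub (by omega)]; push_cast; ring
      rw [this, Int.toNat_natCast]
    have z2 : zbinom (-(C : ℤ)) B = (-1) ^ B * ((C + B - 1).choose B : ℤ) := by
      rw [zbinom, if_neg (by omega)]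
      congr 3
      omega
    have v1 : padicValInt p (p * -(C : ℤ)) = padicValNat p (p * C) := by
      rw [padicValInt]; congr 1; simp [Int.natAbs_mul]
    have v2 : padicValInt p (p * -(C : ℤ) - (p * B : ℕ)) = padicValNat p (p * C + p * B) := by
      rw [padicValInt]; congr 1
      rw [show (p * -(C : ℤ) - (p * B : ℕ)) = -((p * C + p * B : ℕ) : ℤ) by push_cast; ring]
      rw [Int.natAbs_neg, Int.natAbs_natCast]
    rw [v1, v2, z1, z2]
    refine jc_final hp _ _ (jcU p (p * C) * jcU p (p * B)) (jcU p (p * C + p * B)) _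
      (hUV _ _) ?_ ?_
    · have hc := jc_choose hp B C
      have e1 := jc_pred (p * C) (p * B) hpC
      have e2 := jc_pred C B hC
      have hne : (p : ℤ) * ((C + B : ℕ) : ℤ) ≠ 0 :=
        mul_ne_zero hpz (by exact_mod_cast (by omega : C + B ≠ 0))
      refine mul_left_cancel₀ hne ?_
      push_cast at e1 e2 hc ⊢
      linear_combination (-1) ^ B * (jcU p (p * C) * jcU p (p * B)) * e1
        - (-1) ^ B * p * jcU p (p * C + p * B) * e2 + (-1) ^ B * (p * C) * hc
    · have := jc_core' hp hp5 (p * B) (p * C) (dvd_mul_right _ _) (dvd_mul_right _ _) hb (by omega)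
      refine (pow_dvd_pow _ (le_of_eq ?_)).trans this
      ring
  · obtain ⟨n, rfl⟩ := Int.eq_ofNat_of_zero_le hpos
    have z : ∀ m k : ℕ, zbinom (m : ℤ) k = (m.choose k : ℤ) := fun m k => by simp [zbinom]
    have hle : B ≤ n := by
      by_contra h
      rw [z, Nat.choose_eq_zero_of_lt (by omega)] at hnz
      simp at hnz
    obtain ⟨C, rfl⟩ := Nat.exists_eq_add_of_le' hle
    have hC0 : C ≠ 0 := by rintro rfl; simp at hab
    have hpC : p * C ≠ 0 := mul_ne_zero hp.ne_zero hC0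
    have e1 : (p : ℤ) * ((C + B : ℕ) : ℤ) = ((p * C + p * B : ℕ) : ℤ) := by push_cast; ring
    have e2 : ((p * C + p * B : ℕ) : ℤ) - ((p * B : ℕ) : ℤ) = ((p * C : ℕ) : ℤ) := by
      push_cast; ring
    rw [e1, e2, z, z, padicValInt.of_nat, padicValInt.of_nat]
    exact jc_final hp _ _ _ _ _ (hUV _ _) (jc_choose hp B C)
      (jc_core' hp hp5 (p * B) (p * C) (dvd_mul_right _ _) (dvd_mul_right _ _) hb hpC)
end

section
/- Let p be a prime dividing e ≥ 1, let b_i ∈ ℤ for i ≥ 1, and let λ = p·μ be a partition of e all of whose parts are divisible by p, with μ the partition with parts μ_i = λ_i/p. Then ∏_{i≥1} binom(i·b_i·e, λ_i - λ_{i+1}) ≡ (-1)^{(p-1)(e/p + μ_1)} · ∏_{i≥1} binom(i·b_i·e/p, μ_i - μ_{i+1}) (mod p^{2·v_p(e)}). -/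
lemma zbinom_mul_factorial (a : ℤ) (b : ℕ) :
    zbinom a b * (b.factorial : ℤ) = ∏ j ∈ Finset.range b, (a - j) := by
  have key : ∀ (n : ℕ), ((n.choose b : ℕ) : ℤ) * (b.factorial : ℤ)
      = ∏ j ∈ Finset.range b, ((n : ℤ) - j) := by
    intro n
    have h1 : n.choose b * b.factorial = n.descFactorial b := by
      rw [Nat.descFactorial_eq_factorial_mul_choose, mul_comm]
    rw [← Nat.cast_mul, h1]
    by_cases hb : b ≤ n
    · rw [Nat.descFactorial_eq_prod_range, Nat.cast_prod]
      refine Finset.prod_congr rfl fun j hj => ?_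
      have := Finset.mem_range.1 hj
      rw [Nat.cast_sub (by omega)]
    · rw [Nat.descFactorial_of_lt (by omega)]
      symm
      push_cast
      exact Finset.prod_eq_zero (Finset.mem_range.2 (by omega : n < b)) (by simp)
  unfold zbinom
  split_ifs with h
  · rw [key, Int.toNat_of_nonneg h]
  · rw [mul_assoc, key, Int.toNat_of_nonneg (by omega), ← Finset.prod_range_reflect]
    have : ((-1 : ℤ)) ^ b = ∏ j ∈ Finset.range b, (-1 : ℤ) := by simp
    rw [this, ← Finset.prod_mul_distrib]
    refine Finset.prod_congr rfl fun j hj => ?_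
    have := Finset.mem_range.1 hj
    have h2 : ((b - 1 - j : ℕ) : ℤ) = (b : ℤ) - 1 - j := by omega
    rw [h2]; ring

lemma dvd_k_zbinom (A : ℤ) (k : ℕ) : A ∣ (k : ℤ) * zbinom A k := by
  rcases k with _ | k
  · simp
  · refine ⟨zbinom (A - 1) k, ?_⟩
    have h1 := zbinom_mul_factorial A (k + 1)
    have h2 := zbinom_mul_factorial (A - 1) k
    rw [Finset.prod_range_succ'] at h1
    have h3 : ∏ j ∈ Finset.range k, (A - ((j + 1 : ℕ) : ℤ)) = ∏ j ∈ Finset.range k, (A - 1 - j) :=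
      Finset.prod_congr rfl fun j _ => by push_cast; ring
    rw [h3, ← h2, Nat.factorial_succ] at h1
    have hf : (k.factorial : ℤ) ≠ 0 := by exact_mod_cast k.factorial_ne_zero
    apply mul_right_cancel₀ hf
    push_cast at h1 ⊢
    linear_combination h1

/-- product of the numbers below `p*k` prime to `p` -/
def DD (p k : ℕ) : ℤ :=
  ∏ t ∈ Finset.range k, ∏ s ∈ Finset.range (p - 1), ((p : ℤ) * t + s + 1)

/-- shifted product -/
def NN (p k : ℕ) (A : ℤ) : ℤ :=
  ∏ t ∈ Finset.range k, ∏ s ∈ Finset.range (p - 1), ((p : ℤ) * A - (p * t + s + 1))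

lemma prod_range_mul_aux (f : ℕ → ℤ) (p k : ℕ) :
    ∏ j ∈ Finset.range (p * k), f j
      = ∏ t ∈ Finset.range k, ∏ s ∈ Finset.range p, f (p * t + s) := by
  induction k with
  | zero => simp
  | succ k ih => rw [Nat.mul_succ, Finset.prod_range_add, ih, Finset.prod_range_succ]

lemma DF_eq_GN (p k : ℕ) (hp : p.Prime) (A : ℤ) :
    zbinom (p * A) (p * k) * DD p k = zbinom A k * NN p k A := by
  have hp1 : p = (p - 1) + 1 := by have := hp.pos; omega
  have h1 := zbinom_mul_factorial (p * A) (p * k)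
  have h2 := zbinom_mul_factorial A k
  have h3 : (((p * k).factorial : ℕ) : ℤ) = (p : ℤ) ^ k * k.factorial * DD p k := by
    have : (((p * k).factorial : ℕ) : ℤ) = ∏ j ∈ Finset.range (p * k), ((j : ℤ) + 1) := by
      rw [← Finset.prod_range_add_one_eq_factorial]; push_cast; rfl
    have hk : ((k.factorial : ℕ) : ℤ) = ∏ j ∈ Finset.range k, ((j : ℤ) + 1) := by
      rw [← Finset.prod_range_add_one_eq_factorial]; push_cast; rfl
    have hpk : (p : ℤ) ^ k = ∏ j ∈ Finset.range k, (p : ℤ) := by simp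
    rw [this, hk, hpk, prod_range_mul_aux (fun j => (j : ℤ) + 1), DD, ← Finset.prod_mul_distrib,
      ← Finset.prod_mul_distrib]
    refine Finset.prod_congr rfl fun t _ => ?_
    conv_lhs => rw [hp1]
    rw [Finset.prod_range_succ, ← hp1, mul_comm]
    have hc : ((p - 1 : ℕ) : ℤ) = (p : ℤ) - 1 := by omega
    congr 1
    · push_cast; rw [hc]; ring
  have h4 : ∏ j ∈ Finset.range (p * k), ((p : ℤ) * A - j)
      = (p : ℤ) ^ k * (∏ j ∈ Finset.range k, (A - j)) * NN p k A := by
    have hpk : (p : ℤ) ^ k = ∏ j ∈ Finset.range k, (p : ℤ) := by simp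
    rw [hpk, prod_range_mul_aux (fun j => (p : ℤ) * A - j), NN, ← Finset.prod_mul_distrib,
      ← Finset.prod_mul_distrib]
    refine Finset.prod_congr rfl fun t _ => ?_
    conv_lhs => rw [hp1]
    rw [Finset.prod_range_succ', ← hp1, mul_comm]
    congr 1
    · push_cast; ring
  rw [h3, h4, ← h2] at h1
  have hf : (k.factorial : ℤ) ≠ 0 := by exact_mod_cast k.factorial_ne_zero
  have hpp : (p : ℤ) ^ k ≠ 0 := pow_ne_zero _ (by exact_mod_cast hp.ne_zero)
  apply mul_right_cancel₀ (mul_ne_zero hpp hf)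
  linear_combination h1

lemma DD_coprime (p k : ℕ) (hp : p.Prime) : IsCoprime (p : ℤ) (DD p k) := by
  have hp' : Prime (p : ℤ) := Nat.prime_iff_prime_int.1 hp
  unfold DD
  refine IsCoprime.prod_right fun t _ => IsCoprime.prod_right fun s hs => ?_
  have hs' := Finset.mem_range.1 hs
  rw [hp'.coprime_iff_not_dvd]
  intro h
  have h2 : (p : ℤ) ∣ ((s + 1 : ℕ) : ℤ) := by
    have := dvd_sub h (Dvd.intro (t : ℤ) rfl)
    have e : (p : ℤ) * t + s + 1 - p * t = ((s + 1 : ℕ) : ℤ) := by push_cast; ring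
    rwa [e] at this
  have := Nat.le_of_dvd (by omega) (Int.natCast_dvd_natCast.1 h2)
  omega

lemma modEq_prod {ι : Type*} (s : Finset ι) (f g : ι → ℤ) (n : ℤ)
    (h : ∀ i ∈ s, f i ≡ g i [ZMOD n]) : ∏ i ∈ s, f i ≡ ∏ i ∈ s, g i [ZMOD n] := by
  classical
  induction s using Finset.induction_on with
  | empty => simp
  | insert a s ha ih =>
    rw [Finset.prod_insert ha, Finset.prod_insert ha]
    exact Int.ModEq.mul (h a (by simp)) (ih fun i hi => h i (by simp [hi]))

lemma NN_sq (p k : ℕ) (hp : p.Prime) (A : ℤ) :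
    NN p k A ^ 2 ≡ DD p k ^ 2 [ZMOD p ^ 2 * A * (A - k)] := by
  have refl2 : ∀ f : ℕ → ℕ → ℤ,
      ∏ t ∈ Finset.range k, ∏ s ∈ Finset.range (p - 1), f t s
      = ∏ t ∈ Finset.range k, ∏ s ∈ Finset.range (p - 1), f (k - 1 - t) (p - 1 - 1 - s) := by
    intro f
    rw [← Finset.prod_range_reflect]
    refine Finset.prod_congr rfl fun t _ => ?_
    rw [← Finset.prod_range_reflect]
  have e1 : NN p k A ^ 2 = ∏ t ∈ Finset.range k, ∏ s ∈ Finset.range (p - 1),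
      (((p : ℤ) * A - (p * t + s + 1)) *
        ((p : ℤ) * A - (p * ((k - 1 - t : ℕ) : ℤ) + ((p - 1 - 1 - s : ℕ) : ℤ) + 1))) := by
    simp only [Finset.prod_mul_distrib]
    rw [← refl2 (fun t s => ((p : ℤ) * A - (p * t + s + 1))), sq]; rfl
  have e2 : DD p k ^ 2 = ∏ t ∈ Finset.range k, ∏ s ∈ Finset.range (p - 1),
      (((p : ℤ) * t + s + 1) *
        (p * ((k - 1 - t : ℕ) : ℤ) + ((p - 1 - 1 - s : ℕ) : ℤ) + 1)) := by
    simp only [Finset.prod_mul_distrib]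
    rw [← refl2 (fun t s => ((p : ℤ) * t + s + 1)), sq]; rfl
  rw [e1, e2]
  refine modEq_prod _ _ _ _ fun t ht => modEq_prod _ _ _ _ fun s hs => ?_
  have ht' := Finset.mem_range.1 ht
  have hs' := Finset.mem_range.1 hs
  have c1 : ((k - 1 - t : ℕ) : ℤ) = (k : ℤ) - 1 - t := by omega
  have c2 : ((p - 1 - 1 - s : ℕ) : ℤ) = (p : ℤ) - 1 - 1 - s := by omega
  rw [c1, c2]
  symm
  rw [Int.modEq_iff_dvd]
  exact ⟨1, by ring⟩

lemma GA_dvd (A : ℤ) (k : ℕ) (p : ℤ) (r : ℕ) (h : p ^ r ∣ p * A) :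
    p ^ (2 * r) ∣ p ^ 2 * A * (A - k) * zbinom A k := by
  obtain ⟨c, hc⟩ := dvd_k_zbinom A k
  have : p ^ 2 * A * (A - k) * zbinom A k = (p * A) ^ 2 * (zbinom A k - c) := by
    linear_combination (-p ^ 2 * A) * hc
  rw [this, mul_comm 2 r, pow_mul]
  exact Dvd.dvd.mul_right (pow_dvd_pow_of_dvd h 2) _

lemma odd_case (p k r : ℕ) (hp : p.Prime) (hp2 : p ≠ 2) (A : ℤ) (h : (p : ℤ) ^ r ∣ p * A) :
    zbinom (p * A) (p * k) ≡ zbinom A k [ZMOD (p : ℤ) ^ (2 * r)] := by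
  have hp' : Prime (p : ℤ) := Nat.prime_iff_prime_int.1 hp
  have hD := DD_coprime p k hp
  have hND : NN p k A ≡ DD p k [ZMOD p] := by
    have hev : Even (p - 1) := hp.even_sub_one hp2
    have : DD p k = ∏ t ∈ Finset.range k, ∏ s ∈ Finset.range (p - 1), (-((p : ℤ) * t + s + 1)) := by
      unfold DD
      refine Finset.prod_congr rfl fun t _ => ?_
      rw [Finset.prod_neg, Finset.card_range, hev.neg_one_pow, one_mul]
    rw [this]
    refine modEq_prod _ _ _ _ fun t _ => modEq_prod _ _ _ _ fun s _ => ?_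
    symm
    rw [Int.modEq_iff_dvd]
    exact ⟨A, by ring⟩
  have hcop : IsCoprime (p : ℤ) (NN p k A + DD p k) := by
    rw [hp'.coprime_iff_not_dvd]
    intro h1
    have h2 := hND.symm.dvd
    have h3 : (p : ℤ) ∣ 2 * DD p k := by
      have := dvd_sub h1 h2
      have e : NN p k A + DD p k - (NN p k A - DD p k) = 2 * DD p k := by ring
      rwa [e] at this
    rcases hp'.dvd_or_dvd h3 with h4 | h4
    · have : p ∣ 2 := by exact_mod_cast h4
      exact hp2 ((Nat.prime_dvd_prime_iff_eq hp Nat.prime_two).1 this)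
    · exact (hp'.coprime_iff_not_dvd.1 hD) h4
  obtain ⟨c, hc⟩ := (NN_sq p k hp A).symm.dvd
  have hF := DF_eq_GN p k hp A
  symm
  rw [Int.modEq_iff_dvd]
  have h5 : (p : ℤ) ^ (2 * r) ∣ (NN p k A + DD p k) * (DD p k *
      (zbinom (p * A) (p * k) - zbinom A k)) := by
    have : (NN p k A + DD p k) * (DD p k * (zbinom (p * A) (p * k) - zbinom A k))
       = p ^ 2 * A * (A - k) * zbinom A k * c := by
      linear_combination (NN p k A + DD p k) * hF + zbinom A k * hc
    rw [this]
    exact (GA_dvd A k p r h).mul_right _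
  exact (hD.pow_left).dvd_of_dvd_mul_left ((hcop.pow_left).dvd_of_dvd_mul_left h5)

lemma two_even_ND (m : ℕ) (A : ℤ) :
    ∃ c, NN 2 (2 * m) A = DD 2 (2 * m) + 2 ^ 2 * A * (A - (2 * m : ℕ)) * c := by
  have sp : ∀ f : ℕ → ℤ, ∏ t ∈ Finset.range (2 * m), f t
      = ∏ t ∈ Finset.range m, (f t * f (m + (m - 1 - t))) := by
    intro f
    rw [two_mul, Finset.prod_range_add, Finset.prod_mul_distrib,
      Finset.prod_range_reflect (fun t => f (m + t))]
  have : DD 2 (2 * m) ≡ NN 2 (2 * m) A [ZMOD 2 ^ 2 * A * (A - (2 * m : ℕ))] := by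
    unfold DD NN
    rw [sp, sp]
    refine modEq_prod _ _ _ _ fun t ht => ?_
    have ht' := Finset.mem_range.1 ht
    have c1 : ((m - 1 - t : ℕ) : ℤ) = (m : ℤ) - 1 - t := by omega
    rw [Int.modEq_iff_dvd]
    refine ⟨1, ?_⟩
    simp only [Nat.add_one_sub_one, Finset.prod_range_one]
    push_cast
    rw [c1]; ring
  obtain ⟨c, hc⟩ := this.dvd
  exact ⟨c, by linear_combination hc⟩

lemma two_odd_ND (m : ℕ) (A : ℤ) :
    ∃ c D', DD 2 (2 * m + 1) = (2 * m + 1 : ℕ) * D' ∧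
      NN 2 (2 * m + 1) A = (2 * A - (2 * m + 1 : ℕ)) * D'
        + 2 ^ 2 * A * (A - (2 * m + 1 : ℕ)) * c := by
  have sp : ∀ f : ℕ → ℤ, ∏ t ∈ Finset.range (2 * m + 1), f t
      = f m * ∏ t ∈ Finset.range m, (f t * f (m + 1 + (m - 1 - t))) := by
    intro f
    rw [show 2 * m + 1 = m + 1 + m by ring, Finset.prod_range_add, Finset.prod_range_succ,
      Finset.prod_mul_distrib, Finset.prod_range_reflect (fun t => f (m + 1 + t))]
    ring
  have : ∏ t ∈ Finset.range m, ((2 * (t : ℤ) + 1) * (2 * ((m + 1 + (m - 1 - t) : ℕ) : ℤ) + 1))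
     ≡ ∏ t ∈ Finset.range m, ((2 * A - (2 * (t : ℤ) + 1)) *
        (2 * A - (2 * ((m + 1 + (m - 1 - t) : ℕ) : ℤ) + 1)))
      [ZMOD 2 ^ 2 * A * (A - (2 * m + 1 : ℕ))] := by
    refine modEq_prod _ _ _ _ fun t ht => ?_
    have ht' := Finset.mem_range.1 ht
    have c1 : ((m - 1 - t : ℕ) : ℤ) = (m : ℤ) - 1 - t := by omega
    rw [Int.modEq_iff_dvd]
    refine ⟨1, ?_⟩
    push_cast
    rw [c1]; ring
  obtain ⟨c, hc⟩ := this.dvd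
  refine ⟨(2 * A - (2 * m + 1 : ℕ)) * c,
    ∏ t ∈ Finset.range m, ((2 * (t : ℤ) + 1) * (2 * ((m + 1 + (m - 1 - t) : ℕ) : ℤ) + 1)), ?_, ?_⟩
  rotate_left
  · unfold NN
    rw [sp]
    simp only [Nat.add_one_sub_one, Finset.prod_range_one, Nat.cast_zero, add_zero, Nat.cast_ofNat]
    rw [sub_eq_iff_eq_add'.1 hc]
    push_cast
    ring
  · unfold DD
    rw [sp]
    simp only [Nat.add_one_sub_one, Finset.prod_range_one, Nat.cast_zero, add_zero, Nat.cast_ofNat]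
    push_cast
    rfl

lemma two_even (k r : ℕ) (hk : Even k) (A : ℤ) (h : (2 : ℤ) ^ r ∣ 2 * A) :
    zbinom (2 * A) (2 * k) ≡ zbinom A k [ZMOD (2 : ℤ) ^ (2 * r)] := by
  obtain ⟨m, rfl⟩ := hk.two_dvd
  obtain ⟨c, hc⟩ := two_even_ND m A
  have hF := DF_eq_GN 2 (2 * m) Nat.prime_two A
  have hD := DD_coprime 2 (2 * m) Nat.prime_two
  push_cast at hF hD hc
  symm
  rw [Int.modEq_iff_dvd]
  refine (hD.pow_left (m := 2 * r)).dvd_of_dvd_mul_left ?_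
  have : DD 2 (2 * m) * (zbinom (2 * A) (2 * (2 * m)) - zbinom A (2 * m))
     = 2 ^ 2 * A * (A - (2 * m : ℕ)) * zbinom A (2 * m) * c := by
    push_cast
    linear_combination hF + zbinom A (2 * m) * hc
  rw [this]
  exact (GA_dvd A _ 2 r h).mul_right _

lemma two_G_dvd (k r : ℕ) (hk : Odd k) (A : ℤ) (h : (2 : ℤ) ^ r ∣ A) :
    (2 : ℤ) ^ r ∣ zbinom A k := by
  have hc : IsCoprime ((2 : ℤ) ^ r) (k : ℤ) := by
    apply IsCoprime.pow_left
    have := Nat.isCoprime_iff_coprime.2 (Nat.coprime_two_left.2 hk)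
    exact_mod_cast this
  exact hc.dvd_of_dvd_mul_left (h.trans (dvd_k_zbinom A k))

lemma two_odd (k r : ℕ) (hk : Odd k) (A : ℤ) (h : (2 : ℤ) ^ r ∣ A) :
    (2 : ℤ) ^ (2 * r + 1) ∣ zbinom (2 * A) (2 * k) + zbinom A k := by
  have hG := two_G_dvd k r hk A h
  have hg2 := GA_dvd A k 2 (r + 1) (by rw [pow_succ, mul_comm]; exact mul_dvd_mul_left _ h)
  obtain ⟨m, rfl⟩ := hk
  obtain ⟨c, D', hD', hN⟩ := two_odd_ND m A
  have hF := DF_eq_GN 2 (2 * m + 1) Nat.prime_two A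
  have hD := DD_coprime 2 (2 * m + 1) Nat.prime_two
  push_cast at hF hD
  refine (hD.pow_left (m := 2 * r + 1)).dvd_of_dvd_mul_left ?_
  have : DD 2 (2 * m + 1) * (zbinom (2 * A) (2 * (2 * m + 1)) + zbinom A (2 * m + 1))
     = 2 * A * zbinom A (2 * m + 1) * D' +
       2 ^ 2 * A * (A - (2 * m + 1 : ℕ)) * zbinom A (2 * m + 1) * c := by
    linear_combination hF + zbinom A (2 * m + 1) * hN + zbinom A (2 * m + 1) * hD'
  rw [this]
  refine dvd_add (Dvd.dvd.mul_right ?_ _) (Dvd.dvd.mul_right ?_ _)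
  · rw [show (2 : ℤ) ^ (2 * r + 1) = 2 * 2 ^ r * 2 ^ r by ring]
    exact mul_dvd_mul (mul_dvd_mul_left _ h) hG
  · exact (pow_dvd_pow _ (by omega)).trans hg2

lemma two_odd_odd (k : ℕ) (hk : Odd k) (A : ℤ) (h : Odd A) :
    zbinom (2 * A) (2 * k) ≡ zbinom A k [ZMOD 4] := by
  have hAk : (2 : ℤ) ∣ A - k := (h.sub_odd (by exact_mod_cast hk)).two_dvd
  obtain ⟨m, rfl⟩ := hk
  obtain ⟨c, D', hD', hN⟩ := two_odd_ND m A
  have hF := DF_eq_GN 2 (2 * m + 1) Nat.prime_two A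
  have hD := DD_coprime 2 (2 * m + 1) Nat.prime_two
  push_cast at hF hD
  symm
  rw [Int.modEq_iff_dvd, show (4 : ℤ) = 2 ^ 2 by norm_num]
  refine (hD.pow_left (m := 2)).dvd_of_dvd_mul_left ?_
  obtain ⟨x, hx⟩ := hAk
  refine ⟨zbinom A (2 * m + 1) * (D' * x + A * (A - (2 * m + 1 : ℕ)) * c), ?_⟩
  linear_combination hF + zbinom A (2 * m + 1) * hN - zbinom A (2 * m + 1) * hD' +
    2 * zbinom A (2 * m + 1) * D' * hx

/-- generic product lemma -/
lemma two_prod (s : Finset ℕ) (r : ℕ) (hr : 1 ≤ r) (k : ℕ → ℕ) (A : ℕ → ℤ) (M : ℕ)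
    (hM : 2 ^ (r - 1) ∣ M) (hM2 : 2 ≤ r → Even M) (hM3 : r = 1 → Odd M)
    (hA : ∀ i ∈ s, ((i : ℤ) + 1) * 2 ^ (r - 1) ∣ A i)
    (hsum : ∑ i ∈ s, (i + 1) * k i = M) :
    ∏ i ∈ s, zbinom (2 * A i) (2 * k i) ≡ (-1) ^ (M + ∑ i ∈ s, k i) * ∏ i ∈ s, zbinom (A i) (k i)
      [ZMOD (2 : ℤ) ^ (2 * r)] := by
  obtain ⟨r, rfl⟩ : ∃ q, r = q + 1 := ⟨r - 1, by omega⟩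
  simp only [Nat.add_sub_cancel] at *
  have hA' : ∀ i ∈ s, (2 : ℤ) ^ r ∣ A i := fun i hi => (Dvd.intro_left _ rfl).trans (hA i hi)
  have hA2 : ∀ i ∈ s, (2 : ℤ) ^ (r + 1) ∣ 2 * A i := fun i hi => by
    rw [pow_succ, mul_comm]; exact mul_dvd_mul_left _ (hA' i hi)
  have weak : ∀ i ∈ s, zbinom (2 * A i) (2 * k i) ≡ (-1) ^ k i * zbinom (A i) (k i)
      [ZMOD (2 : ℤ) ^ (2 * r + 1)] := by
    intro i hi
    rcases Nat.even_or_odd (k i) with h | h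
    · rw [h.neg_one_pow, one_mul]
      exact (two_even _ (r + 1) h _ (hA2 i hi)).of_dvd (pow_dvd_pow _ (by omega))
    · rw [h.neg_one_pow]
      symm
      rw [Int.modEq_iff_dvd]
      have := two_odd _ r h _ (hA' i hi)
      convert this using 1; ring
  have strong : ∀ i ∈ s, (Odd (k i) → (2 : ℤ) ^ (r + 1) ∣ A i) →
      zbinom (2 * A i) (2 * k i) ≡ (-1) ^ k i * zbinom (A i) (k i)
      [ZMOD (2 : ℤ) ^ (2 * (r + 1))] := by
    intro i hi hh
    rcases Nat.even_or_odd (k i) with h | h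
    · rw [h.neg_one_pow, one_mul]
      exact (two_even _ (r + 1) h _ (hA2 i hi))
    · rw [h.neg_one_pow]
      symm
      rw [Int.modEq_iff_dvd]
      have := two_odd _ (r + 1) h _ (hh h)
      refine (pow_dvd_pow _ (by omega)).trans (this.trans (dvd_of_eq (by ring)))
  have prodsign : ∀ t : Finset ℕ, ∏ i ∈ t, ((-1 : ℤ) ^ k i * zbinom (A i) (k i))
      = (-1) ^ (∑ i ∈ t, k i) * ∏ i ∈ t, zbinom (A i) (k i) := by
    intro t
    rw [Finset.prod_mul_distrib, Finset.prod_pow_eq_pow_sum]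
  rcases Nat.eq_zero_or_pos r with hr0 | hr0
  · subst hr0
    by_cases hall : ∀ i ∈ s, Odd (k i) → Odd (A i)
    · have hs : Even (M + ∑ i ∈ s, k i) := by
        rw [← hsum, ← Finset.sum_add_distrib]
        refine Finset.even_sum _ fun i hi => ?_
        rcases Nat.even_or_odd (k i) with h | h
        · exact (h.mul_left _).add h
        · have h1 : Odd ((i : ℤ) + 1) :=
            by
              obtain ⟨y, hy⟩ := (Dvd.intro _ rfl : ((i : ℤ) + 1) ∣ _).trans (hA i hi)
              have h0 := hall i hi h
              rw [hy] at h0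
              exact Int.Odd.of_mul_left h0
          have h2 : Odd (i + 1) := by exact_mod_cast h1
          exact (h2.mul h).add_odd h
      rw [hs.neg_one_pow, one_mul]
      refine modEq_prod _ _ _ _ fun i hi => ?_
      rcases Nat.even_or_odd (k i) with h | h
      · exact two_even _ 1 h _ (by simp)
      · exact two_odd_odd _ h _ (hall i hi h)
    · push Not at hall
      obtain ⟨i, hi, hki, hAi⟩ := hall
      have hAi2 : (2 : ℤ) ^ 1 ∣ A i := by
        rw [pow_one]; exact (Int.not_odd_iff_even.1 hAi).two_dvd
      have hG := two_G_dvd _ 1 hki _ hAi2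
      have hFG := two_odd _ 1 hki _ hAi2
      rw [← Finset.mul_prod_erase s _ hi, ← Finset.mul_prod_erase s _ hi]
      have hR := modEq_prod (s.erase i) _ _ _ fun j hj => weak j (Finset.mem_of_mem_erase hj)
      rw [prodsign] at hR
      obtain ⟨g, hg⟩ := hG
      obtain ⟨f, hf⟩ := hFG
      obtain ⟨x, hx⟩ := hR.dvd
      set RF := ∏ j ∈ s.erase i, zbinom (2 * A j) (2 * k j)
      set RG := ∏ j ∈ s.erase i, zbinom (A j) (k j)
      have hF : zbinom (2 * A i) (2 * k i) = 8 * f - 2 * g := by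
        norm_num at hf hg
        linear_combination hf - hg
      rw [hF, hg]
      rw [Int.modEq_iff_dvd]
      norm_num at hx ⊢
      rcases neg_one_pow_eq_or ℤ (M + ∑ i ∈ s, k i) with h1 | h1 <;>
      rcases neg_one_pow_eq_or ℤ (∑ i ∈ s.erase i, k i) with h2 | h2 <;>
      rw [h1] <;> rw [h2] at hx
      · exact ⟨g * RG - 2 * f * RF - g * x, by linear_combination (-2 * g) * hx⟩
      · exact ⟨- 2 * f * RF - g * x, by linear_combination (-2 * g) * hx⟩
      · exact ⟨- 2 * f * RF - g * x, by linear_combination (-2 * g) * hx⟩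
      · exact ⟨-g * RG - 2 * f * RF - g * x, by linear_combination (-2 * g) * hx⟩
  · have hMe := hM2 (by omega)
    rw [pow_add, hMe.neg_one_pow, one_mul]
    by_cases hall : ∀ i ∈ s, Odd (k i) → Even (i + 1)
    · rw [← prodsign]
      refine modEq_prod _ _ _ _ fun i hi => strong i hi fun h => ?_
      refine Dvd.dvd.trans ?_ (hA i hi)
      rw [pow_succ, mul_comm]
      refine mul_dvd_mul_right ?_ _
      exact_mod_cast (hall i hi h).two_dvd
    · push Not at hall
      obtain ⟨i, hi, hki, hie⟩ := hall
      have hex : ∃ j ∈ s.erase i, Odd (k j) := by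
        by_contra hcon
        push Not at hcon
        have h1 : Even (∑ j ∈ s.erase i, (j + 1) * k j) :=
          Finset.even_sum _ fun j hj => (Nat.not_odd_iff_even.1 (hcon j hj)).mul_left _
        rw [← Finset.add_sum_erase s _ hi] at hsum
        have h2 : Odd ((i + 1) * k i) := (Nat.not_even_iff_odd.1 hie).mul hki
        have := h2.add_even h1
        rw [hsum] at this
        exact (Nat.not_even_iff_odd.2 this) hMe
      obtain ⟨j, hj, hkj⟩ := hex
      have hjs := Finset.mem_of_mem_erase hj
      have hR := modEq_prod ((s.erase i).erase j) _ _ _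
        fun l hl => weak l (Finset.mem_of_mem_erase (Finset.mem_of_mem_erase hl))
      rw [prodsign] at hR
      obtain ⟨gi, hgi⟩ := two_G_dvd _ r hki _ (hA' i hi)
      obtain ⟨gj, hgj⟩ := two_G_dvd _ r hkj _ (hA' j hjs)
      obtain ⟨fi, hfi⟩ := two_odd _ r hki _ (hA' i hi)
      obtain ⟨fj, hfj⟩ := two_odd _ r hkj _ (hA' j hjs)
      obtain ⟨x, hx⟩ := hR.dvd
      rw [← Finset.mul_prod_erase s _ hi, ← Finset.mul_prod_erase _ _ hj,
        ← Finset.mul_prod_erase s (fun i => zbinom (A i) (k i)) hi,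
        ← Finset.mul_prod_erase _ (fun i => zbinom (A i) (k i)) hj,
        ← Finset.add_sum_erase s _ hi, ← Finset.add_sum_erase _ _ hj, pow_add, pow_add,
        hki.neg_one_pow, hkj.neg_one_pow]
      set RF := ∏ l ∈ (s.erase i).erase j, zbinom (2 * A l) (2 * k l)
      set RG := ∏ l ∈ (s.erase i).erase j, zbinom (A l) (k l)
      set E := ((-1 : ℤ)) ^ (∑ l ∈ (s.erase i).erase j, k l)
      rw [eq_sub_of_add_eq hfi, eq_sub_of_add_eq hfj]
      obtain ⟨q, rfl⟩ : ∃ q, r = q + 1 := ⟨r - 1, by omega⟩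
      simp only [hgi, hgj]
      rw [Int.modEq_iff_dvd]
      -- with T = 2^(q+1): modulus 4 T^2, errors T^3 * 2 and T^4 * 2
      refine ⟨2 ^ q * gi * gj * 2 ^ q * 2 * x
        - RF * (2 ^ (q + 1) * 2 ^ (q + 1) * fi * fj - 2 ^ q * fi * gj - 2 ^ q * gi * fj), ?_⟩
      have e1 : (2 : ℤ) ^ (q + 1) = 2 * 2 ^ q := by ring
      have e2 : (2 : ℤ) ^ (2 * (q + 1) + 1) = 8 * (2 ^ q) ^ 2 := by ring
      have e3 : (2 : ℤ) ^ (2 * (q + 1 + 1)) = 16 * (2 ^ q) ^ 2 := by ring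
      rw [e2] at hx
      rw [e1, e2, e3]
      linear_combination (4 * (2 ^ q) ^ 2 * gi * gj) * hx

lemma abel_sum (mu : ℕ → ℕ) (h : Antitone mu) (n : ℕ) :
    ∑ i ∈ Finset.range n, (i + 1) * (mu i - mu (i + 1)) + n * mu n
      = ∑ i ∈ Finset.range n, mu i := by
  induction n with
  | zero => simp
  | succ n ih =>
    rw [Finset.sum_range_succ, Finset.sum_range_succ, ← ih]
    obtain ⟨d, hd⟩ := Nat.exists_eq_add_of_le (h (Nat.le_succ n))
    simp only [Nat.succ_eq_add_one] at hd
    rw [hd, Nat.add_sub_cancel_left]; ring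

lemma tele_sum (mu : ℕ → ℕ) (h : Antitone mu) (n : ℕ) :
    ∑ i ∈ Finset.range n, (mu i - mu (i + 1)) + mu n = mu 0 := by
  induction n with
  | zero => simp
  | succ n ih =>
    rw [Finset.sum_range_succ, ← ih]
    have := h (Nat.le_succ n)
    simp only [Nat.succ_eq_add_one] at this
    omega

/-- (Lemma `claim1`.)  Let `p` be a prime dividing `e ≥ 1`, `bᵢ ∈ ℤ`, and let `λ = p·μ`
be a partition of `e` all of whose parts are divisible by `p`, with `μ` (encoded as an
antitone `mu : ℕ → ℕ` with `mu (i-1) = μᵢ`) the corresponding partition of `e/p`.  Then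
`∏_{i≥1} binom(i bᵢ e, λᵢ - λ_{i+1}) ≡ (-1)^{(p-1)(e/p + μ₁)} ∏_{i≥1} binom(i bᵢ e/p, μᵢ - μ_{i+1})`
modulo `p^{2 v_p(e)}` (products truncated at `i = e`, beyond which all factors are `1`). -/
theorem claim1_congruence (p e : ℕ) (hp : p.Prime) (he : 1 ≤ e) (hpe : p ∣ e)
    (b : ℕ → ℤ) (mu : ℕ → ℕ) (hanti : Antitone mu)
    (hsum : ∑ i ∈ Finset.range (e / p), mu i = e / p) (hlast : mu (e / p) = 0) :
    (∏ i ∈ Finset.range e,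
        zbinom (((i : ℤ) + 1) * b (i + 1) * (e : ℤ)) (p * mu i - p * mu (i + 1)))
      ≡ (-1) ^ ((p - 1) * (e / p + mu 0)) *
          ∏ i ∈ Finset.range e,
            zbinom (((i : ℤ) + 1) * b (i + 1) * ((e / p : ℕ) : ℤ)) (mu i - mu (i + 1))
      [ZMOD (p : ℤ) ^ (2 * padicValNat p e)] := by
  obtain ⟨f, rfl⟩ := hpe
  have hpp := hp.pos
  have hf : f ≠ 0 := by rintro rfl; simp at he
  rw [Nat.mul_div_cancel_left _ hpp] at *
  have hfact : Fact p.Prime := ⟨hp⟩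
  have hval : padicValNat p (p * f) = padicValNat p f + 1 := by
    rw [padicValNat.mul hp.ne_zero hf, padicValNat_self, add_comm]
  have hfd : p ^ padicValNat p f ∣ f := pow_padicValNat_dvd
  rw [hval]
  set r := padicValNat p f with hr
  have hle : f ≤ p * f := Nat.le_mul_of_pos_left _ hpp
  have hz : ∀ i, f ≤ i → mu i = 0 := fun i hi => by
    have := hanti hi; omega
  have hrw : ∀ i : ℕ, zbinom (((i : ℤ) + 1) * b (i + 1) * ((p * f : ℕ) : ℤ)) (p * mu i - p * mu (i + 1))
      = zbinom (p * (((i : ℤ) + 1) * b (i + 1) * (f : ℤ))) (p * (mu i - mu (i + 1))) := by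
    intro i
    rw [← Nat.mul_sub]
    congr 1
    push_cast; ring
  simp only [hrw]
  have hfdz : (p : ℤ) ^ r ∣ (f : ℤ) := by exact_mod_cast hfd
  by_cases hp2 : p = 2
  · subst hp2
    have hs1 := abel_sum mu hanti (2 * f)
    have hs2 := tele_sum mu hanti (2 * f)
    rw [hz _ hle] at hs1 hs2
    have hs3 : ∑ i ∈ Finset.range (2 * f), mu i = f := by
      refine Eq.trans (Eq.symm ?_) hsum
      refine Finset.sum_subset (Finset.range_mono hle) fun i _ hi => hz i ?_
      simpa using hi
    rw [hs3] at hs1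
    simp only [mul_zero, add_zero] at hs1 hs2
    have := two_prod (Finset.range (2 * f)) (r + 1) (by omega) (fun i => mu i - mu (i + 1))
      (fun i => ((i : ℤ) + 1) * b (i + 1) * (f : ℤ)) f (by simpa using hfd)
      (fun h => even_iff_two_dvd.2 ((dvd_pow_self 2 (by omega)).trans hfd))
      (fun h => by
        have h0 : padicValNat 2 f = 0 := by omega
        rw [← Nat.not_even_iff_odd, even_iff_two_dvd]
        intro h2
        have := one_le_padicValNat_of_dvd hf h2
        omega)
      (fun i _ => by
        simp only [Nat.add_sub_cancel]
        rw [mul_assoc]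
        exact mul_dvd_mul_left _ (Dvd.dvd.mul_left (by exact_mod_cast hfdz) _))
      hs1
    rw [hs2] at this
    simpa using this
  · have hev : Even ((p - 1) * (f + mu 0)) := (hp.even_sub_one hp2).mul_right _
    rw [hev.neg_one_pow, one_mul]
    refine modEq_prod _ _ _ _ fun i _ => odd_case p _ (r + 1) hp hp2 _ ?_
    rw [pow_succ, mul_comm]
    exact mul_dvd_mul_left _ (Dvd.dvd.mul_left hfdz _)
end

section
/- Let Q be a finite quiver with vertex set I and r_{i,j} arrows from i to j. For each vertex i, let Q_i be the tree of paths starting at i, and for a dimension vector n ∈ ℕ^I let f^n(d) be the number of n-forests of dimension vector d (tuples of subtrees T_{i,k} of Q_i, k=1..n_i, closed under predecessors, with total dimension vector d). Then the generating series F^n(t) = Σ_d f^n(d) t^d satisfy: (1) F^n(t) = ∏_{i∈I} F^i(t)^{n_i}, and (2) F^i(t) = 1 + t_i ∏_{j∈I} F^j(t)^{r_{i,j}}, and these equations determine the F^n uniquely. -/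
open scoped Classical

/-- An arrow of the quiver with vertex set `I` and `r i j` arrows from `i` to `j`:
a source, a target, and a label. -/
def QArrow {I : Type} (r : I → I → ℕ) : Type := Σ i j : I, Fin (r i j)

/-- `IsPathFrom r i l` : the list of arrows `l` is a path in the quiver starting at the
vertex `i` (arrows composed from left to right). -/
def IsPathFrom {I : Type} (r : I → I → ℕ) (i : I) : List (QArrow r) → Prop
  | [] => True
  | a :: l => a.1 = i ∧ IsPathFrom r a.2.1 l

/-- The end vertex of a path starting at `i`. -/
def endVertex {I : Type} (r : I → I → ℕ) (i : I) : List (QArrow r) → I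
  | [] => i
  | a :: l => endVertex r a.2.1 l

/-- A subtree of the path tree `Q_i` (vertices of `Q_i` = paths in `Q` starting at `i`):
a finite set of paths from `i`, closed under predecessors (i.e. under prefixes). -/
def IsSubtree {I : Type} (r : I → I → ℕ) (i : I) (T : Finset (List (QArrow r))) : Prop :=
  (∀ l ∈ T, IsPathFrom r i l) ∧ ∀ l ∈ T, ∀ l', l' <+: l → l' ∈ T

/-- The number `f^n(d)` of `n`-forests of dimension vector `d`: tuples
`(T_{i,k})_{i ∈ I, k = 1,…,nᵢ}` of subtrees of the trees `Q_i` such that for every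
vertex `j` the total number of paths in the forest ending at `j` is `d j`. -/
noncomputable def forestCount {I : Type} [Fintype I] (r : I → I → ℕ) (n : I → ℕ)
    (d : I →₀ ℕ) : ℕ :=
  Nat.card {T : ∀ i : I, Fin (n i) → Finset (List (QArrow r)) //
    (∀ i k, IsSubtree r i (T i k)) ∧
    ∀ j : I, (∑ i, ∑ k, ((T i k).filter fun l => endVertex r i l = j).card) = d j}

/-- The generating series `F^n(t) = ∑_d f^n(d) t^d ∈ ℚ[[tᵢ : i ∈ I]]`. -/
noncomputable def forestSeries {I : Type} [Fintype I] (r : I → I → ℕ) (n : I → ℕ) :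
    MvPowerSeries I ℚ :=
  fun d => (forestCount r n d : ℚ)

/-- generating function of a weighted class -/
noncomputable def wgf {I A : Type} (w : A → (I →₀ ℕ)) : MvPowerSeries I ℚ :=
  fun d => (Nat.card {a : A // w a = d} : ℚ)

theorem coeff_wgf {I A : Type} (w : A → (I →₀ ℕ)) (d : I →₀ ℕ) :
    MvPowerSeries.coeff d (wgf w) = (Nat.card {a : A // w a = d} : ℚ) := rfl

theorem wgf_equiv {I A B : Type} (w : A → (I →₀ ℕ)) (v : B → (I →₀ ℕ)) (e : A ≃ B)
    (h : ∀ a, v (e a) = w a) : wgf w = wgf v := by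
  ext d
  rw [coeff_wgf, coeff_wgf]
  congr 1
  exact Nat.card_congr (e.subtypeEquiv (fun a => by rw [h]))

/-- fibers of the product weight -/
noncomputable def piFiberEquiv {I K : Type} [Fintype K] {A : K → Type} (w : ∀ k, A k → (I →₀ ℕ))
    (d : I →₀ ℕ) :
    {f : ∀ k, A k // ∑ k, w k (f k) = d} ≃
      Σ l : {l : K →₀ (I →₀ ℕ) // l ∈ Finset.finsuppAntidiag Finset.univ d},
        ∀ k, {a : A k // w k a = l.1 k} where
  toFun f := ⟨⟨Finsupp.equivFunOnFinite.symm (fun k => w k (f.1 k)), by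
    simp [Finset.mem_finsuppAntidiag, f.2]⟩, fun k => ⟨f.1 k, by simp⟩⟩
  invFun x := ⟨fun k => (x.2 k).1, by
    have := x.1.2
    rw [Finset.mem_finsuppAntidiag] at this
    exact (Finset.sum_congr rfl (fun k _ => (x.2 k).2)).trans this.1⟩
  left_inv f := rfl
  right_inv x := by
    obtain ⟨⟨l, hl⟩, g⟩ := x
    obtain ⟨a, ha⟩ : ∃ a : ∀ k, A k, ∀ k, a k = (g k).1 := ⟨fun k => (g k).1, fun _ => rfl⟩
    have hg : ∀ k, w k (a k) = l k := fun k => by rw [ha k]; exact (g k).2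
    obtain rfl : g = fun k => ⟨a k, hg k⟩ := by
      funext k
      exact Subtype.ext (ha k).symm
    have : Finsupp.equivFunOnFinite.symm (fun k => w k (a k)) = l := by
      ext1 k
      simp [hg k]
    subst this
    rfl

theorem wgf_pi {I K : Type} [Fintype K] {A : K → Type} (w : ∀ k, A k → (I →₀ ℕ))
    (hw : ∀ k d, Finite {a : A k // w k a = d}) :
    wgf (fun f : ∀ k, A k => ∑ k, w k (f k)) = ∏ k, wgf (w k) := by
  ext d
  rw [MvPowerSeries.coeff_prod, coeff_wgf, Nat.card_congr (piFiberEquiv w d), Nat.card_sigma]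
  simp only [Nat.card_pi, coeff_wgf]
  push_cast
  rw [← Finset.sum_coe_sort (Finset.finsuppAntidiag Finset.univ d)]

theorem finite_pi {I K : Type} [Fintype K] {A : K → Type} (w : ∀ k, A k → (I →₀ ℕ))
    (hw : ∀ k d, Finite {a : A k // w k a = d}) (d : I →₀ ℕ) :
    Finite {f : ∀ k, A k // ∑ k, w k (f k) = d} :=
  Finite.of_equiv _ (piFiberEquiv w d).symm

/-- fibers on an option type -/
def optFiberEquiv {B : Type} (P : Option B → Prop) :
    {a : Option B // P a} ≃ PLift (P none) ⊕ {b : B // P (some b)} where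
  toFun a := match a with
    | ⟨none, h⟩ => Sum.inl ⟨h⟩
    | ⟨some b, h⟩ => Sum.inr ⟨b, h⟩
  invFun a := match a with
    | Sum.inl h => ⟨none, h.down⟩
    | Sum.inr b => ⟨some b.1, b.2⟩
  left_inv a := by rcases a with ⟨_ | b, h⟩ <;> rfl
  right_inv a := by rcases a with h | b <;> rfl

theorem wgf_option {I B : Type} (w : B → (I →₀ ℕ)) (i : I)
    (hw : ∀ d, Finite {a : B // w a = d}) :
    wgf (fun o : Option B => o.elim 0 (fun b => Finsupp.single i 1 + w b))
      = 1 + MvPowerSeries.X i * wgf w := by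
  ext d
  have key : {b : B // Finsupp.single i 1 + w b = d} ≃
      {b : B // Finsupp.single i 1 ≤ d ∧ w b = d - Finsupp.single i 1} :=
    Equiv.subtypeEquivRight (fun b => by
      constructor
      · rintro rfl
        simp
      · rintro ⟨h1, h2⟩
        rw [h2, add_tsub_cancel_of_le h1])
  have fin1 : Finite {b : B // Finsupp.single i 1 + w b = d} := by
    refine @Finite.of_equiv _ _ ?_ key.symm
    exact Finite.of_injective
      (β := {b : B // w b = d - Finsupp.single i 1}) (fun b => ⟨b.1, b.2.2⟩)
      (fun a b h => Subtype.ext (congrArg (fun x => x.1) h))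
  rw [coeff_wgf, Nat.card_congr (optFiberEquiv _)]
  have fin2 : Finite {b : B // (fun o : Option B => o.elim 0
    (fun b => Finsupp.single i 1 + w b)) (some b) = d} := fin1
  have fin3 : Finite (PLift ((fun o : Option B => o.elim 0
    (fun b => Finsupp.single i 1 + w b)) none = d)) := inferInstance
  rw [Nat.card_sum, map_add, MvPowerSeries.X, MvPowerSeries.coeff_monomial_mul,
    MvPowerSeries.coeff_one]
  push_cast
  congr 1
  · simp only [Option.elim]
    by_cases h : d = 0
    · subst h
      simp
    · rw [if_neg h]
      have : IsEmpty (PLift (0 = d)) := ⟨fun x => h x.down.symm⟩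
      simp
  · simp only [Option.elim]
    rw [Nat.card_congr key]
    by_cases h : Finsupp.single i 1 ≤ d
    · simp [h, coeff_wgf]
    · simp [h]

/-- agreement of power series in total degree below `N` -/
def AgreeBelow {I : Type} (N : ℕ) (f g : MvPowerSeries I ℚ) : Prop :=
  ∀ d : I →₀ ℕ, d.degree < N → MvPowerSeries.coeff d f = MvPowerSeries.coeff d g

theorem AgreeBelow.mul {I : Type} {N : ℕ} {f g f' g' : MvPowerSeries I ℚ}
    (h : AgreeBelow N f g) (h' : AgreeBelow N f' g') : AgreeBelow N (f * f') (g * g') := by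
  intro d hd
  rw [MvPowerSeries.coeff_mul, MvPowerSeries.coeff_mul]
  refine Finset.sum_congr rfl (fun p hp => ?_)
  rw [Finset.HasAntidiagonal.mem_antidiagonal] at hp
  have : p.1.degree + p.2.degree = d.degree := by rw [← hp, map_add]
  rw [h p.1 (by omega), h' p.2 (by omega)]

theorem AgreeBelow.pow {I : Type} {N : ℕ} {f g : MvPowerSeries I ℚ}
    (h : AgreeBelow N f g) (k : ℕ) : AgreeBelow N (f ^ k) (g ^ k) := by
  induction k with
  | zero => intro d _; simp
  | succ k ih => rw [pow_succ, pow_succ]; exact ih.mul h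

theorem AgreeBelow.prod {I K : Type} {N : ℕ} (s : Finset K) {f g : K → MvPowerSeries I ℚ}
    (h : ∀ k, AgreeBelow N (f k) (g k)) : AgreeBelow N (∏ k ∈ s, f k) (∏ k ∈ s, g k) := by
  induction s using Finset.induction_on with
  | empty => intro d _; simp
  | insert a s ha ih => rw [Finset.prod_insert ha, Finset.prod_insert ha]; exact (h a).mul ih

theorem series_unique {I : Type} [Fintype I] (r : I → I → ℕ) (f g : I → MvPowerSeries I ℚ)
    (hf : ∀ i, f i = 1 + MvPowerSeries.X i * ∏ j, f j ^ r i j)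
    (hg : ∀ i, g i = 1 + MvPowerSeries.X i * ∏ j, g j ^ r i j) : f = g := by
  have main : ∀ N i, AgreeBelow N (f i) (g i) := by
    intro N
    induction N with
    | zero => intro i d hd; omega
    | succ N ih =>
      intro i d hd
      rw [hf i, hg i, map_add, map_add, MvPowerSeries.X, MvPowerSeries.coeff_monomial_mul,
        MvPowerSeries.coeff_monomial_mul]
      congr 1
      split_ifs with h
      · congr 1
        refine AgreeBelow.prod _ (fun j => (ih j).pow (r i j)) _ ?_
        have h2 : (Finsupp.single i 1 + (d - Finsupp.single i 1)).degree = d.degree := by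
          rw [add_tsub_cancel_of_le h]
        rw [map_add, Finsupp.degree_single] at h2
        omega
      · rfl
  funext i
  ext d
  exact main (d.degree + 1) i d (by omega)

/-- subtrees as a type -/
def Tr {I : Type} (r : I → I → ℕ) (i : I) : Type :=
  {T : Finset (List (QArrow r)) // IsSubtree r i T}

/-- dimension vector of a finite set of paths -/
noncomputable def trWt {I : Type} (r : I → I → ℕ) (i : I) (T : Tr r i) : I →₀ ℕ :=
  ∑ l ∈ T.1, Finsupp.single (endVertex r i l) 1

theorem trWt_apply {I : Type} (r : I → I → ℕ) (i : I) (T : Tr r i) (j : I) :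
    trWt r i T j = (T.1.filter fun l => endVertex r i l = j).card := by
  rw [trWt, Finsupp.finsetSum_apply, Finset.card_filter]
  refine Finset.sum_congr rfl (fun l _ => ?_)
  rw [Finsupp.single_apply]

instance {I : Type} [Finite I] (r : I → I → ℕ) : Finite (QArrow r) := by
  unfold QArrow; infer_instance

theorem tr_length {I : Type} (r : I → I → ℕ) (i : I) (T : Tr r i) (l : List (QArrow r))
    (hl : l ∈ T.1) : l.length < (trWt r i T).degree := by
  have h1 : (trWt r i T).degree = T.1.card := by
    rw [trWt, map_sum]; simp [Finsupp.degree_single]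
  rw [h1]
  have h2 : (Finset.range (l.length + 1)).card ≤ T.1.card := by
    refine Finset.card_le_card_of_injOn (fun k => l.take k) ?_ ?_
    · intro k _
      exact T.2.2 l hl _ ⟨l.drop k, List.take_append_drop k l⟩
    · intro a ha b hb hab
      have := congrArg List.length hab
      simp at this ha hb
      omega
  simpa using h2

theorem tr_finite {I : Type} [Finite I] (r : I → I → ℕ) (i : I) (d : I →₀ ℕ) :
    Finite {T : Tr r i // trWt r i T = d} := by
  have hfin : {l : List (QArrow r) | l.length < d.degree}.Finite :=
    List.finite_length_lt _ _
  refine Finite.of_injective (β := hfin.toFinset.powerset) (fun T => ⟨T.1.1, ?_⟩) ?_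
  · rw [Finset.mem_powerset]
    intro l hl
    have := tr_length r i T.1 l hl
    rw [T.2] at this
    simpa using this
  · intro a b h
    exact Subtype.ext (Subtype.ext (congrArg (fun x => x.1) h))

/-- forests as a product of trees -/
def forestEquiv {I : Type} [Fintype I] (r : I → I → ℕ) (n : I → ℕ) (d : I →₀ ℕ) :
    {T : ∀ i : I, Fin (n i) → Finset (List (QArrow r)) //
    (∀ i k, IsSubtree r i (T i k)) ∧
    ∀ j : I, (∑ i, ∑ k, ((T i k).filter fun l => endVertex r i l = j).card) = d j} ≃
    {f : ∀ p : (Σ i, Fin (n i)), Tr r p.1 // ∑ p, trWt r p.1 (f p) = d} where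
  toFun T := ⟨fun p => ⟨T.1 p.1 p.2, T.2.1 p.1 p.2⟩, by
    ext j
    rw [Finsupp.finsetSum_apply, ← T.2.2 j, Fintype.sum_sigma]
    exact Finset.sum_congr rfl (fun i _ => Finset.sum_congr rfl (fun k _ => trWt_apply r i _ j))⟩
  invFun f := ⟨fun i k => (f.1 ⟨i, k⟩).1, fun i k => (f.1 ⟨i, k⟩).2, fun j => by
    have h := DFunLike.congr_fun f.2 j
    rw [Finsupp.finsetSum_apply, Fintype.sum_sigma] at h
    rw [← h]
    exact Finset.sum_congr rfl
      (fun i _ => Finset.sum_congr rfl (fun k _ => (trWt_apply r i _ j).symm))⟩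
  left_inv _ := rfl
  right_inv _ := rfl

theorem forest_eq {I : Type} [Fintype I] (r : I → I → ℕ) (n : I → ℕ) :
    forestSeries r n = ∏ i, wgf (trWt r i) ^ n i := by
  have h := wgf_pi (fun p : (Σ i, Fin (n i)) => trWt r p.1) (fun p d => tr_finite r p.1 d)
  rw [Fintype.prod_sigma] at h
  simp only [Finset.prod_const, Finset.card_univ, Fintype.card_fin] at h
  rw [← h]
  ext d
  rw [coeff_wgf]
  change ((forestCount r n d : ℕ) : ℚ) = _
  rw [forestCount, Nat.card_congr (forestEquiv r n d)]

theorem forest_single {I : Type} [Fintype I] [DecidableEq I] (r : I → I → ℕ) (i : I) :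
    (forestSeries r fun j => if j = i then 1 else 0) = wgf (trWt r i) := by
  rw [forest_eq, Finset.prod_eq_single i]
  · simp
  · intro b _ hb; simp [hb]
  · simp

/-- build an arrow -/
def mkArrow {I : Type} (r : I → I → ℕ) (i : I) (p : Σ j, Fin (r i j)) : QArrow r := ⟨i, p⟩

/-- prepend an arrow -/
def consArrow {I : Type} (r : I → I → ℕ) (i : I) (p : Σ j, Fin (r i j))
    (l : List (QArrow r)) : List (QArrow r) := mkArrow r i p :: l

theorem consArrow_inj {I : Type} (r : I → I → ℕ) (i : I) (p q : Σ j, Fin (r i j))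
    (l m : List (QArrow r)) (h : consArrow r i p l = consArrow r i q m) : p = q ∧ l = m := by
  unfold consArrow at h
  rw [List.cons.injEq] at h
  refine ⟨?_, h.2⟩
  have h1 := h.1
  exact eq_of_heq (Sigma.mk.inj h1).2

/-- grafting of trees: underlying set -/
noncomputable def graftSet {I : Type} [Fintype I] (r : I → I → ℕ) (i : I)
    (S : ∀ p : (Σ j, Fin (r i j)), Tr r p.1) : Finset (List (QArrow r)) :=
  insert [] (Finset.univ.biUnion fun p => (S p).1.image (consArrow r i p))

theorem nil_mem_graftSet {I : Type} [Fintype I] (r : I → I → ℕ) (i : I)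
    (S : ∀ p : (Σ j, Fin (r i j)), Tr r p.1) : [] ∈ graftSet r i S := by
  simp [graftSet]

theorem cons_mem_graftSet {I : Type} [Fintype I] (r : I → I → ℕ) (i : I)
    (S : ∀ p : (Σ j, Fin (r i j)), Tr r p.1) (p : Σ j, Fin (r i j)) (l : List (QArrow r)) :
    consArrow r i p l ∈ graftSet r i S ↔ l ∈ (S p).1 := by
  unfold graftSet
  rw [Finset.mem_insert]
  simp only [Finset.mem_biUnion, Finset.mem_univ, true_and, Finset.mem_image]
  constructor
  · rintro (h | ⟨q, m, hm, h⟩)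
    · simp [consArrow] at h
    · obtain ⟨rfl, rfl⟩ := consArrow_inj r i _ _ _ _ h
      exact hm
  · intro h
    exact Or.inr ⟨p, l, h, rfl⟩

theorem mem_graftSet {I : Type} [Fintype I] (r : I → I → ℕ) (i : I)
    (S : ∀ p : (Σ j, Fin (r i j)), Tr r p.1) (l : List (QArrow r)) (h : l ∈ graftSet r i S) :
    l = [] ∨ ∃ p, ∃ m ∈ (S p).1, l = consArrow r i p m := by
  unfold graftSet at h
  rw [Finset.mem_insert] at h
  simp only [Finset.mem_biUnion, Finset.mem_univ, true_and, Finset.mem_image] at h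
  rcases h with h | ⟨q, m, hm, h⟩
  · exact Or.inl h
  · exact Or.inr ⟨q, m, hm, h.symm⟩

theorem graftSet_isSubtree {I : Type} [Fintype I] (r : I → I → ℕ) (i : I)
    (S : ∀ p : (Σ j, Fin (r i j)), Tr r p.1) : IsSubtree r i (graftSet r i S) := by
  constructor
  · intro l hl
    rcases mem_graftSet r i S l hl with rfl | ⟨p, m, hm, rfl⟩
    · trivial
    · exact ⟨rfl, (S p).2.1 m hm⟩
  · intro l hl l' hl'
    rcases mem_graftSet r i S l hl with rfl | ⟨p, m, hm, rfl⟩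
    · rw [List.prefix_nil] at hl'
      subst hl'
      exact hl
    · unfold consArrow at hl'
      rw [List.prefix_cons_iff] at hl'
      rcases hl' with rfl | ⟨t, rfl, ht⟩
      · exact nil_mem_graftSet r i S
      · exact (cons_mem_graftSet r i S p t).2 ((S p).2.2 m hm t ht)

/-- grafting -/
noncomputable def graft {I : Type} [Fintype I] (r : I → I → ℕ) (i : I) :
    Option (∀ p : (Σ j, Fin (r i j)), Tr r p.1) → Tr r i
  | none => ⟨∅, by simp [IsSubtree]⟩
  | some S => ⟨graftSet r i S, graftSet_isSubtree r i S⟩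

theorem graft_wt {I : Type} [Fintype I] (r : I → I → ℕ) (i : I)
    (o : Option (∀ p : (Σ j, Fin (r i j)), Tr r p.1)) :
    trWt r i (graft r i o) =
      o.elim 0 (fun S => Finsupp.single i 1 + ∑ p, trWt r p.1 (S p)) := by
  rcases o with _ | S
  · simp [trWt, graft]
  · simp only [Option.elim, trWt, graft, graftSet]
    rw [Finset.sum_insert, Finset.sum_biUnion]
    · congr 1
      refine Finset.sum_congr rfl (fun p _ => ?_)
      rw [Finset.sum_image]
      · rfl
      · intro a _ b _ h
        exact (consArrow_inj r i p p a b h).2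
    · intro p _ q _ hpq
      rw [Function.onFun, Finset.disjoint_left]
      intro l hl hl'
      rw [Finset.mem_image] at hl hl'
      obtain ⟨a, _, rfl⟩ := hl
      obtain ⟨b, _, h⟩ := hl'
      exact hpq (consArrow_inj r i _ _ _ _ h).1.symm
    · simp [consArrow]

theorem graft_bij {I : Type} [Fintype I] (r : I → I → ℕ) (i : I) :
    Function.Bijective (graft r i) := by
  constructor
  · rintro (_ | S) (_ | S') h
    · rfl
    · have h1 : (∅ : Finset (List (QArrow r))) = graftSet r i S' := congrArg (fun x => x.1) h
      have := nil_mem_graftSet r i S'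
      rw [← h1] at this
      simp at this
    · have h1 : graftSet r i S = (∅ : Finset (List (QArrow r))) := congrArg (fun x => x.1) h
      have := nil_mem_graftSet r i S
      rw [h1] at this
      simp at this
    · have h1 : graftSet r i S = graftSet r i S' := congrArg (fun x => x.1) h
      congr 1
      funext p
      refine Subtype.ext (Finset.ext fun l => ?_)
      rw [← cons_mem_graftSet r i S, h1, cons_mem_graftSet]
  · intro T
    by_cases hT : T.1 = ∅
    · exact ⟨none, Subtype.ext hT.symm⟩
    · obtain ⟨l0, hl0⟩ := Finset.nonempty_iff_ne_empty.2 hT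
      have hnil : [] ∈ T.1 := T.2.2 l0 hl0 [] ⟨l0, rfl⟩
      have hinj : ∀ p : (Σ j, Fin (r i j)), Function.Injective (consArrow r i p) :=
        fun p a b h => (consArrow_inj r i p p a b h).2
      refine ⟨some (fun p => ⟨T.1.preimage (consArrow r i p) (hinj p).injOn, ?_, ?_⟩), ?_⟩
      · intro l hl
        rw [Finset.mem_preimage] at hl
        exact (T.2.1 _ hl).2
      · intro l hl l' hl'
        rw [Finset.mem_preimage] at hl ⊢
        refine T.2.2 _ hl _ ?_
        unfold consArrow
        rw [List.prefix_cons_inj]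
        exact hl'
      · refine Subtype.ext (Finset.ext fun l => ?_)
        change l ∈ graftSet r i _ ↔ _
        rcases l with _ | ⟨⟨i', p⟩, l⟩
        · exact iff_of_true (nil_mem_graftSet r i _) hnil
        · constructor
          · intro h
            rcases mem_graftSet r i _ _ h with h | ⟨q, m, hm, h⟩
            · simp at h
            · rw [h]
              exact (Finset.mem_preimage (hf := (hinj q).injOn)).1 hm
          · intro h
            have hi : i' = i := (T.2.1 _ h).1
            subst hi
            refine (cons_mem_graftSet r i' _ p l).2 ?_
            exact (Finset.mem_preimage (hf := (hinj p).injOn)).2 h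

theorem tr_eq {I : Type} [Fintype I] (r : I → I → ℕ) (i : I) :
    wgf (trWt r i) = 1 + MvPowerSeries.X i * ∏ j, wgf (trWt r j) ^ r i j := by
  rw [← wgf_equiv _ (trWt r i) (Equiv.ofBijective _ (graft_bij r i)) (graft_wt r i),
    wgf_option _ i (finite_pi (fun p : (Σ j, Fin (r i j)) => trWt r p.1)
      (fun p d => tr_finite r p.1 d)),
    wgf_pi (fun p : (Σ j, Fin (r i j)) => trWt r p.1) (fun p d => tr_finite r p.1 d),
    Fintype.prod_sigma]
  simp

/-- (Proposition `grafting`.)  The generating series `F^n` of `n`-forests satisfy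
(1) `F^n = ∏_{i∈I} (F^i)^{nᵢ}`  and  (2) `F^i = 1 + tᵢ ∏_{j∈I} (F^j)^{r_{i,j}}`
(where `F^i` denotes `F^n` for `n` the indicator vector of `i`), and they are uniquely
determined by these functional equations. -/
theorem forest_series_functional_equations {I : Type} [Fintype I] [DecidableEq I]
    (r : I → I → ℕ) :
    (∀ n : I → ℕ, forestSeries r n
        = ∏ i : I, (forestSeries r fun j => if j = i then 1 else 0) ^ n i)
      ∧ (∀ i : I, (forestSeries r fun j => if j = i then 1 else 0)
          = 1 + MvPowerSeries.X i *
              ∏ j : I, (forestSeries r fun j' => if j' = j then 1 else 0) ^ r i j)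
      ∧ ∀ G : (I → ℕ) → MvPowerSeries I ℚ,
          (∀ n : I → ℕ, G n = ∏ i : I, (G fun j => if j = i then 1 else 0) ^ n i) →
          (∀ i : I, (G fun j => if j = i then 1 else 0)
              = 1 + MvPowerSeries.X i *
                  ∏ j : I, (G fun j' => if j' = j then 1 else 0) ^ r i j) →
          ∀ n : I → ℕ, G n = forestSeries r n := by
  refine ⟨fun n => ?_, fun i => ?_, fun G h1 h2 n => ?_⟩
  · simp only [forest_single]
    exact forest_eq r n
  · simp only [forest_single]
    exact tr_eq r i
  · have h := series_unique r (fun i => G fun j => if j = i then 1 else 0)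
      (fun i => wgf (trWt r i)) h2 (tr_eq r)
    rw [h1 n, forest_eq]
    exact Finset.prod_congr rfl (fun i _ => by rw [← congrFun h i])
end

section
/- Fix integers b_i for i ≥ 1 and the (a_d) defined by d²·a_d = Σ_{e|d} μ(d/e)(-1)^e Σ_{λ⊢e}(-1)^{λ_1} ∏_{i≥1} binom(i b_i e, λ_i - λ_{i+1}). For any prime p with p^m || d (m ≥ 1), the difference Σ_{e|d, v_p(e)=m} μ(d/e)(-1)^e Σ_{λ⊢e}(-1)^{λ_1}∏_i binom(i b_i e, λ_i-λ_{i+1}) − Σ_{e|d, v_p(e)=m} μ(d/e)(-1)^{e/p} Σ_{μ'⊢e/p}(-1)^{μ'_1}∏_i binom(i b_i e/p, μ'_i-μ'_{i+1}) is divisible by p^{2m}. Consequently d²·a_d (as given by the above sum) is divisible by p^{2m}, i.e. a_d ∈ ℤ_{(p)}. -/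
open scoped Classical in
/-- The (finite) set of partitions `λ` of `e`, encoded as functions `l : ℕ → ℕ` with
`l (i-1) = λᵢ` (so `l 0 = λ₁`), antitone and summing to `e`; all parts beyond index
`e+2` vanish automatically. -/
noncomputable def partitionFinset (e : ℕ) : Finset (ℕ → ℕ) :=
  (Finset.univ.filter fun l : Fin (e + 2) → Fin (e + 1) =>
      (∀ i j, i ≤ j → l j ≤ l i) ∧ ∑ i, (l i : ℕ) = e).image
    fun l n => if h : n < e + 2 then (l ⟨n, h⟩ : ℕ) else 0

/-- The inner partition sum `∑_{λ⊢e} (-1)^{λ₁} ∏_{i≥1} binom(i bᵢ e, λᵢ - λ_{i+1})`. -/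
noncomputable def partSum (b : ℕ → ℤ) (e : ℕ) : ℤ :=
  ∑ l ∈ partitionFinset e, (-1) ^ (l 0) *
    ∏ i ∈ Finset.range (e + 1), zbinom (((i : ℤ) + 1) * b (i + 1) * (e : ℤ)) (l i - l (i + 1))

open Finset in
theorem zb_fact (a : ℤ) (k : ℕ) :
    (k.factorial : ℤ) * zbinom a k = ∏ j ∈ range k, (a - (j : ℤ)) := by
  unfold zbinom
  split_ifs with h
  · obtain ⟨n, rfl⟩ := Int.eq_ofNat_of_zero_le h
    rw [← descPochhammer_eval_eq_prod_range, descPochhammer_eval_eq_descFactorial,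
      Nat.descFactorial_eq_factorial_mul_choose]
    simp
  · obtain ⟨c, hc⟩ := Int.eq_ofNat_of_zero_le (show 0 ≤ -a - 1 by omega)
    have ha : a = -((c : ℤ) + 1) := by omega
    subst ha
    have h1 : ((k : ℤ) - 1 - -((c : ℤ) + 1)).toNat = c + k := by omega
    rw [h1]
    have h2 := Nat.ascFactorial_eq_factorial_mul_choose c k
    rw [Nat.ascFactorial_eq_prod_range] at h2
    have h3 : (∏ j ∈ range k, (-((c : ℤ) + 1) - (j : ℤ)))
        = (-1) ^ k * ∏ j ∈ range k, ((c : ℤ) + 1 + j) := by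
      rw [← Finset.card_range k, ← Finset.prod_const, Finset.card_range, ← Finset.prod_mul_distrib]
      refine Finset.prod_congr rfl fun j _ => ?_
      ring
    rw [h3]
    have h4 : (∏ j ∈ range k, ((c : ℤ) + 1 + j)) = (k.factorial : ℤ) * ((c + k).choose k : ℤ) := by
      exact_mod_cast h2
    rw [h4]; ring

theorem zb_zero (a : ℤ) : zbinom a 0 = 1 := by
  have := zb_fact a 0
  simpa using this

theorem zb_dvd (a : ℤ) (k : ℕ) : a ∣ (k : ℤ) * zbinom a k := by
  rcases k with _ | n
  · simp
  · refine ⟨zbinom (a - 1) n, ?_⟩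
    have h1 := zb_fact a (n + 1)
    have h2 := zb_fact (a - 1) n
    have h0 : (n.factorial : ℤ) ≠ 0 := by exact_mod_cast n.factorial_ne_zero
    apply mul_left_cancel₀ h0
    rw [Finset.prod_range_succ'] at h1
    have h3 : ∏ j ∈ Finset.range n, (a - ((j + 1 : ℕ) : ℤ))
        = ∏ j ∈ Finset.range n, (a - 1 - (j : ℤ)) := by
      refine Finset.prod_congr rfl fun j _ => ?_
      push_cast; ring
    rw [h3, ← h2, Nat.factorial_succ] at h1
    push_cast at h1 ⊢
    linear_combination h1

/-- product of `X - j`, `j < p k` prime to `p`. -/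
def PP (p k : ℕ) (X : ℤ) : ℤ :=
  ∏ j ∈ (Finset.range (p * k)).filter (fun j => ¬ p ∣ j), (X - (j : ℤ))

theorem prod_split (p k : ℕ) (hp : 0 < p) (N : ℤ) :
    ∏ j ∈ Finset.range (p * k), ((p : ℤ) * N - (j : ℤ))
      = (p : ℤ) ^ k * (∏ j ∈ Finset.range k, (N - (j : ℤ))) * PP p k (p * N) := by
  rw [← Finset.prod_filter_mul_prod_filter_not (Finset.range (p * k)) (fun j => p ∣ j)]
  unfold PP
  congr 1
  have h : (Finset.range (p * k)).filter (fun j => p ∣ j)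
      = (Finset.range k).image (fun j => p * j) := by
    ext j
    simp only [Finset.mem_filter, Finset.mem_range, Finset.mem_image]
    constructor
    · rintro ⟨h1, c, rfl⟩
      exact ⟨c, lt_of_mul_lt_mul_left h1 (Nat.zero_le p), rfl⟩
    · rintro ⟨c, h1, rfl⟩
      exact ⟨Nat.mul_lt_mul_of_pos_left h1 hp, dvd_mul_right _ _⟩
  rw [h, Finset.prod_image (by
    intro x _ y _ hxy
    exact Nat.eq_of_mul_eq_mul_left hp hxy)]
  conv_rhs => rw [← Finset.card_range k, ← Finset.prod_const, Finset.card_range,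
    ← Finset.prod_mul_distrib]
  refine Finset.prod_congr rfl fun j _ => ?_
  push_cast; ring

theorem zb_self (n : ℕ) : zbinom (n : ℤ) n = 1 := by
  unfold zbinom; simp

theorem zb_mul (p k : ℕ) (hp : 0 < p) (N : ℤ) :
    PP p k (p * k) * zbinom (p * N) (p * k) = zbinom N k * PP p k (p * N) := by
  have h1 := zb_fact (p * N) (p * k)
  rw [prod_split p k hp N, ← zb_fact N k] at h1
  have h2 := zb_fact (p * (k : ℤ)) (p * k)
  rw [prod_split p k hp k, ← zb_fact k k, zb_self] at h2
  have h3 := zb_self (p * k)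
  push_cast at h3
  rw [h3] at h2
  rw [mul_one, mul_one] at h2
  have h0 : (p : ℤ) ^ k * (k.factorial : ℤ) ≠ 0 := by
    have := k.factorial_ne_zero
    positivity
  apply mul_left_cancel₀ h0
  rw [h2] at h1
  linear_combination h1

theorem PP_not_dvd (p k : ℕ) (hp : p.Prime) : ¬ (p : ℤ) ∣ PP p k (p * k) := by
  unfold PP
  rw [(Nat.prime_iff_prime_int.mp hp).dvd_finsetProd_iff]
  rintro ⟨j, hj, h⟩
  simp only [Finset.mem_filter] at hj
  apply hj.2
  have : (p : ℤ) ∣ (j : ℤ) := (dvd_sub_right (dvd_mul_right _ _)).mp h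
  exact_mod_cast this

theorem dvd_prod_sub (n : ℤ) (s : Finset ℕ) (f g : ℕ → ℤ) (h : ∀ i ∈ s, n ∣ f i - g i) :
    n ∣ ∏ i ∈ s, f i - ∏ i ∈ s, g i := by
  classical
  induction s using Finset.induction_on with
  | empty => simp
  | insert a s ha ih =>
    rw [Finset.prod_insert ha, Finset.prod_insert ha]
    have h1 := ih fun i hi => h i (Finset.mem_insert_of_mem hi)
    have h2 := h a (Finset.mem_insert_self _ _)
    have : f a * ∏ i ∈ s, f i - g a * ∏ i ∈ s, g i
      = (f a - g a) * ∏ i ∈ s, f i + g a * (∏ i ∈ s, f i - ∏ i ∈ s, g i) := by ring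
    rw [this]
    exact dvd_add (h2.mul_right _) (h1.mul_left _)

/-- the lower half of the product, paired -/
def RR (p k : ℕ) (X : ℤ) : ℤ :=
  ∏ j ∈ (Finset.range (p * k)).filter (fun j => ¬ p ∣ j ∧ 2 * j < p * k),
    ((X - (j : ℤ)) * (X - ((p * k : ℤ) - j)))

theorem RR_dvd (p k : ℕ) (M : ℤ) : M * (M - p * k) ∣ RR p k M - RR p k (p * k) := by
  unfold RR
  apply dvd_prod_sub
  intro i _
  exact ⟨1, by ring⟩

theorem PP_eq (p k : ℕ) (X : ℤ) : PP p k X = RR p k X *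
    ∏ j ∈ (Finset.range (p * k)).filter (fun j => ¬ p ∣ j ∧ 2 * j = p * k), (X - (j : ℤ)) := by
  classical
  unfold PP RR
  rw [Finset.prod_mul_distrib]
  have h : ∏ j ∈ (Finset.range (p * k)).filter (fun j => ¬ p ∣ j ∧ 2 * j < p * k),
      (X - ((p * k : ℤ) - j))
      = ∏ j ∈ (Finset.range (p * k)).filter (fun j => ¬ p ∣ j ∧ p * k < 2 * j), (X - (j : ℤ)) := by
    refine Finset.prod_nbij' (fun j => p * k - j) (fun j => p * k - j) ?_ ?_ ?_ ?_ ?_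
    · intro j hj
      simp only [Finset.mem_filter, Finset.mem_range] at hj ⊢
      have h0 : j ≠ 0 := by rintro rfl; simp at hj
      refine ⟨by omega, fun h => hj.2.1 ?_, by omega⟩
      exact (Nat.dvd_sub_iff_right hj.1.le (dvd_mul_right _ _)).mp h
    · intro j hj
      simp only [Finset.mem_filter, Finset.mem_range] at hj ⊢
      refine ⟨by omega, fun h => hj.2.1 ?_, by omega⟩
      exact (Nat.dvd_sub_iff_right hj.1.le (dvd_mul_right _ _)).mp h
    · intro j hj
      simp only [Finset.mem_filter, Finset.mem_range] at hj ⊢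
      omega
    · intro j hj
      simp only [Finset.mem_filter, Finset.mem_range] at hj ⊢
      omega
    · intro j hj
      simp only [Finset.mem_filter, Finset.mem_range] at hj ⊢
      rw [Nat.cast_sub hj.1.le]; push_cast; ring
  rw [h, ← Finset.prod_union, ← Finset.prod_union]
  · refine Finset.prod_congr ?_ fun _ _ => rfl
    ext j
    simp only [Finset.mem_filter, Finset.mem_union]
    have := lt_trichotomy (2 * j) (p * k)
    tauto
  · rw [Finset.disjoint_left]
    intro j hj
    simp only [Finset.mem_filter, Finset.mem_union] at hj ⊢
    omega
  · rw [Finset.disjoint_left]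
    intro j hj
    simp only [Finset.mem_filter] at hj ⊢
    omega

theorem PP_eq_good (p k : ℕ) (h : p ≠ 2 ∨ Even k) (hp : p.Prime) (X : ℤ) :
    PP p k X = RR p k X := by
  rw [PP_eq, Finset.filter_false_of_mem, Finset.prod_empty, mul_one]
  rintro j _ ⟨h1, h2⟩
  rcases h with h | ⟨r, rfl⟩
  · have : p ∣ 2 * j := h2 ▸ dvd_mul_right _ _
    rcases (Nat.Prime.dvd_mul hp).mp this with h3 | h3
    · exact h ((Nat.prime_dvd_prime_iff_eq hp Nat.prime_two).mp h3)
    · exact h1 h3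
  · apply h1
    exact ⟨r, by linarith [mul_add p r r]⟩

theorem PP_eq_odd (k : ℕ) (h : Odd k) (X : ℤ) : PP 2 k X = RR 2 k X * (X - k) := by
  rw [PP_eq]
  have : (Finset.range (2 * k)).filter (fun j => ¬ 2 ∣ j ∧ 2 * j = 2 * k) = {k} := by
    ext j
    obtain ⟨r, rfl⟩ := h
    simp only [Finset.mem_filter, Finset.mem_range, Finset.mem_singleton]
    omega
  rw [this, Finset.prod_singleton]

theorem sq_dvd (p k : ℕ) (N : ℤ) :
    ((p : ℤ) * N) ^ 2 ∣ zbinom N k * ((p * N) * (p * N - p * k)) := by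
  obtain ⟨c, hc⟩ := zb_dvd N k
  exact ⟨zbinom N k - c, by linear_combination (-(p : ℤ) ^ 2 * N) * hc⟩

theorem cancel_P {p : ℕ} (hp : p.Prime) {Q x : ℤ} {n : ℕ} (hQ : ¬ (p : ℤ) ∣ Q)
    (h : (p : ℤ) ^ n ∣ Q * x) : (p : ℤ) ^ n ∣ x :=
  (IsCoprime.pow_left ((Nat.prime_iff_prime_int.mp hp).coprime_iff_not_dvd.mpr hQ)).dvd_of_dvd_mul_left h

theorem zb_good (p k m : ℕ) (hp : p.Prime) (h : p ≠ 2 ∨ Even k) (N : ℤ)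
    (hM : (p : ℤ) ^ m ∣ p * N) :
    (p : ℤ) ^ (2 * m) ∣ zbinom (p * N) (p * k) - zbinom N k := by
  apply cancel_P hp (PP_not_dvd p k hp)
  rw [mul_sub, zb_mul p k hp.pos]
  have h1 : (p : ℤ) ^ (2 * m) ∣ (p * N) ^ 2 := by
    rw [mul_comm, pow_mul]; exact pow_dvd_pow_of_dvd hM 2
  refine h1.trans ((sq_dvd p k N).trans ?_)
  rw [PP_eq_good p k h hp, PP_eq_good p k h hp]
  exact (mul_dvd_mul_left (zbinom N k) (RR_dvd p k (p * N))).trans (dvd_of_eq (by ring))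

theorem zb_odd_aux (k : ℕ) (hk : Odd k) (N : ℤ) :
    ∃ R : ℤ, PP 2 k (2 * k) = R * k ∧ 
      (2 * N) ^ 2 ∣ PP 2 k (2 * k) * (zbinom (2 * N) (2 * k) + zbinom N k)
        - zbinom N k * (2 * N) * R := by
  refine ⟨RR 2 k (2 * k), ?_, ?_⟩
  · rw [PP_eq_odd k hk]; ring
  · have h1 := zb_mul 2 k two_pos N
    push_cast at h1
    rw [mul_add, h1, PP_eq_odd k hk, PP_eq_odd k hk]
    have h2 := sq_dvd 2 k N
    push_cast at h2
    refine h2.trans ?_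
    have h3 := mul_dvd_mul_left (zbinom N k) (RR_dvd 2 k (2 * N))
    push_cast at h3
    refine (h3.mul_right (2 * N - k)).trans (dvd_of_eq ?_)
    ring

theorem zb_odd_dvd (k n : ℕ) (hk : Odd k) (N : ℤ) (hN : (2 : ℤ) ^ n ∣ N) :
    (2 : ℤ) ^ n ∣ zbinom N k := by
  have := hN.trans (zb_dvd N k)
  refine cancel_P Nat.prime_two (Q := k) ?_ (by exact_mod_cast this)
  have := hk.not_two_dvd_nat
  exact_mod_cast this

/-- general statement in the case `p = 2`, `k` odd -/
theorem zb_odd (k n t : ℕ) (hk : Odd k) (N : ℤ) (hN : (2 : ℤ) ^ n ∣ N) (ht : t ≤ 2 * n + 1) :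
    (2 : ℤ) ^ t ∣ zbinom (2 * N) (2 * k) + zbinom N k := by
  obtain ⟨R, -, hR⟩ := zb_odd_aux k hk N
  have hY := zb_odd_dvd k n hk N hN
  refine cancel_P Nat.prime_two (PP_not_dvd 2 k Nat.prime_two) ?_
  push_cast
  have h1 : (2 : ℤ) ^ (2 * n + 1) ∣ (2 * N) ^ 2 := by
    obtain ⟨c, rfl⟩ := hN
    exact ⟨2 * c ^ 2, by ring⟩
  have h2 : (2 : ℤ) ^ (2 * n + 1) ∣ zbinom N k * (2 * N) * R := by
    obtain ⟨c, hc⟩ := hN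
    obtain ⟨y, hy⟩ := hY
    rw [hy, hc]
    exact ⟨y * c * R, by ring⟩
  exact (pow_dvd_pow 2 ht).trans ((dvd_iff_dvd_of_dvd_sub (h1.trans hR)).mpr h2)

theorem zb_four (k : ℕ) (N : ℤ) :
    (4 : ℤ) ∣ zbinom (2 * N) (2 * k) - zbinom N k := by
  rcases Nat.even_or_odd k with hk | hk
  · have := zb_good 2 k 1 Nat.prime_two (Or.inr hk) N (by simp)
    norm_num at this
    exact this
  · rcases Int.even_or_odd N with hN | hN
    · have h1 := zb_odd k 1 2 hk N (by simpa using hN.two_dvd) (by omega)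
      have h2 := zb_odd_dvd k 1 hk N (by simpa using hN.two_dvd)
      norm_num at h1 h2
      omega
    · obtain ⟨R, hP, hR⟩ := zb_odd_aux k hk N
      have hodd : Odd (PP 2 k (2 * k)) := by
        have := PP_not_dvd 2 k Nat.prime_two
        push_cast at this
        rwa [← Int.not_even_iff_odd, even_iff_two_dvd]
      have hRodd : Odd R := by
        rw [hP] at hodd
        exact (Int.odd_mul.mp hodd).1
      have h4 : (4 : ℤ) ∣ (2 * N) ^ 2 := ⟨N ^ 2, by ring⟩
      have h5 := h4.trans hR
      obtain ⟨q, hq⟩ := hodd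
      obtain ⟨r, hr⟩ := hRodd
      obtain ⟨n, hn⟩ := hN
      obtain ⟨w, hw⟩ := h5
      refine cancel_P (n := 2) (Q := PP 2 k (2 * k)) Nat.prime_two (PP_not_dvd 2 k Nat.prime_two) ?_
      push_cast
      set X := zbinom (2 * N) (2 * k)
      set Y := zbinom N k
      rw [hq] at hw ⊢
      rw [hr, hn] at hw
      refine ⟨w + Y * (2 * n * r + n + r) - Y * q , ?_⟩
      linear_combination hw

theorem nondiv (p m n : ℕ) (hp : p.Prime) (B : ℕ → ℤ) (k : ℕ → ℕ) (e : ℕ) (he : p ^ m ∣ e)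
    (hsum : ∑ i ∈ Finset.range n, (i + 1) * k i = e)
    (hex : ∃ i ∈ Finset.range n, ¬ p ∣ k i) :
    (p : ℤ) ^ (2 * m) ∣ ∏ i ∈ Finset.range n, zbinom (((i : ℤ) + 1) * B i * (e : ℤ)) (k i) := by
  obtain ⟨i, hi, hki⟩ := hex
  have heZ : (p : ℤ) ^ m ∣ (e : ℤ) := by exact_mod_cast he
  obtain ⟨v, u, hu, hv⟩ := Nat.exists_eq_pow_mul_and_not_dvd (n := i + 1) (by omega) p hp.ne_one
  have h1 : (p : ℤ) ^ (v + m) ∣ zbinom (((i : ℤ) + 1) * B i * (e : ℤ)) (k i) := by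
    refine cancel_P hp (Q := k i) (by exact_mod_cast hki) ?_
    refine dvd_trans ?_ (zb_dvd _ _)
    have : ((i : ℤ) + 1) = (p : ℤ) ^ v * u := by exact_mod_cast hv
    rw [this, pow_add]
    exact mul_dvd_mul ((dvd_mul_right _ _).mul_right _) heZ
  rcases le_or_gt m v with hmv | hmv
  · exact (pow_dvd_pow _ (by omega)).trans (h1.trans (Finset.dvd_prod_of_mem _ hi))
  · have h2 : ∃ j ∈ (Finset.range n).erase i, ¬ p ^ (v + 1) ∣ (j + 1) * k j := by
      by_contra! hcon
      have h3 := Finset.dvd_sum hcon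
      rw [← Finset.add_sum_erase _ _ hi] at hsum
      have h4 : p ^ (v + 1) ∣ (i + 1) * k i := by
        rw [Nat.dvd_add_iff_left h3, hsum]
        exact (pow_dvd_pow p hmv).trans he
      rw [hv, pow_succ, mul_assoc] at h4
      have h5 := Nat.dvd_of_mul_dvd_mul_left (pow_pos hp.pos v) h4
      rcases hp.dvd_mul.mp h5 with h | h
      · exact hu h
      · exact hki h
    obtain ⟨j, hj, hjw⟩ := h2
    have hw0 : (j + 1) * k j ≠ 0 := fun h => hjw (h ▸ dvd_zero _)
    obtain ⟨a, u', hu', ha⟩ := Nat.exists_eq_pow_mul_and_not_dvd hw0 p hp.ne_one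
    have hav : a ≤ v := by
      by_contra hcon
      apply hjw
      rw [ha]
      exact (pow_dvd_pow p (by omega)).mul_right _
    have h6 : (p : ℤ) ^ (m - a) ∣ zbinom (((j : ℤ) + 1) * B j * (e : ℤ)) (k j) := by
      refine cancel_P hp (Q := u') (by exact_mod_cast hu') ?_
      have h7 : (p : ℤ) ^ m ∣ ((j : ℤ) + 1) * (k j * zbinom (((j : ℤ) + 1) * B j * (e : ℤ)) (k j)) :=
        (heZ.trans ((dvd_mul_left _ _).trans (zb_dvd _ _))).mul_left _
      have haZ : ((j : ℤ) + 1) * k j = (p : ℤ) ^ a * u' := by exact_mod_cast ha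
      rw [← mul_assoc, haZ, mul_assoc, show m = a + (m - a) by omega, pow_add] at h7
      have hp0 : (p : ℤ) ^ a ≠ 0 := pow_ne_zero _ (by exact_mod_cast hp.ne_zero)
      simpa using (mul_dvd_mul_iff_left hp0).mp h7
    rw [← Finset.mul_prod_erase _ _ hi]
    have h8 := mul_dvd_mul h1 (h6.trans (Finset.dvd_prod_of_mem
      (fun j : ℕ => zbinom (((j : ℤ) + 1) * B j * (e : ℤ)) (k j)) hj))
    refine dvd_trans ?_ h8
    rw [← pow_add]
    exact pow_dvd_pow _ (by omega)

theorem main_prod_two (n : ℕ) (N : ℕ → ℤ) (k : ℕ → ℕ) (E m : ℕ) (hm : 2 ≤ m)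
    (hE : 2 ^ (m - 1) ∣ E) (hN : ∀ i : ℕ, ((i : ℤ) + 1) * E ∣ N i)
    (hsum : ∑ i ∈ Finset.range n, (i + 1) * k i = E) :
    (2 : ℤ) ^ (2 * m) ∣ ∏ i ∈ Finset.range n, zbinom (2 * N i) (2 * k i)
      - ∏ i ∈ Finset.range n, (-1) ^ (k i) * zbinom (N i) (k i) := by
  have hEZ : (2 : ℤ) ^ (m - 1) ∣ (E : ℤ) := by exact_mod_cast hE
  have hN1 : ∀ i, (2 : ℤ) ^ (m - 1) ∣ N i := fun i =>
    hEZ.trans ((dvd_mul_left _ _).trans (hN i))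
  set X : ℕ → ℤ := fun i => zbinom (2 * N i) (2 * k i) with hX
  set Y : ℕ → ℤ := fun i => (-1) ^ (k i) * zbinom (N i) (k i) with hY
  have hEeven : Even E := by
    rw [even_iff_two_dvd]
    exact (dvd_pow_self 2 (by omega)).trans hE
  have hgood : ∀ i, ¬ Odd ((i + 1) * k i) → (2 : ℤ) ^ (2 * m) ∣ X i - Y i := by
    intro i hi
    rcases Nat.even_or_odd (k i) with hk | hk
    · have := zb_good 2 (k i) m Nat.prime_two (Or.inr hk) (N i) (by
        push_cast
        rw [show m = (m - 1) + 1 by omega, pow_succ, mul_comm]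
        exact mul_dvd_mul_left _ (hN1 i))
      simp only [hX, hY, hk.neg_one_pow, one_mul]
      exact_mod_cast this
    · have hi1 : Even (i + 1) := by
        by_contra h
        exact hi ((Nat.not_even_iff_odd.mp h).mul hk)
      have h2 : (2 : ℤ) ^ m ∣ N i := by
        refine dvd_trans ?_ (hN i)
        rw [show m = 1 + (m - 1) by omega, pow_add]
        refine mul_dvd_mul ?_ hEZ
        have := hi1.two_dvd
        rw [pow_one]; exact_mod_cast this
      have := zb_odd (k i) m (2 * m) hk (N i) h2 (by omega)
      simp only [hX, hY, hk.neg_one_pow]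
      simpa using this
  have hbad : ∀ i, Odd ((i + 1) * k i) → (2 : ℤ) ^ (2 * m - 1) ∣ X i - Y i ∧ 2 ∣ X i ∧ 2 ∣ Y i := by
    intro i hi
    have hk : Odd (k i) := (Nat.odd_mul.mp hi).2
    have h1 : (2 : ℤ) ^ (2 * m - 1) ∣ X i - Y i := by
      have := zb_odd (k i) (m - 1) (2 * m - 1) hk (N i) (hN1 i) (by omega)
      simp only [hX, hY, hk.neg_one_pow]
      simpa using this
    have h2 : (2 : ℤ) ∣ Y i := by
      refine Dvd.dvd.mul_left ?_ _
      exact (dvd_pow_self 2 (by omega)).trans (zb_odd_dvd (k i) (m - 1) hk (N i) (hN1 i))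
    have h3 : (2 : ℤ) ∣ X i - Y i := (dvd_pow_self 2 (by omega)).trans h1
    exact ⟨h1, (dvd_iff_dvd_of_dvd_sub h3).mpr h2, h2⟩
  rw [← Finset.prod_filter_mul_prod_filter_not (Finset.range n) (fun i => Odd ((i + 1) * k i)) X,
    ← Finset.prod_filter_mul_prod_filter_not (Finset.range n) (fun i => Odd ((i + 1) * k i)) Y]
  set S := (Finset.range n).filter (fun i => Odd ((i + 1) * k i)) with hS
  have hSc : ¬ Odd S.card := by
    rw [hS, ← Finset.odd_sum_iff_odd_card_odd, hsum]
    exact Nat.not_odd_iff_even.mpr hEeven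
  have hA := dvd_prod_sub ((2 : ℤ) ^ (2 * m))
    ((Finset.range n).filter (fun i => ¬ Odd ((i + 1) * k i))) X Y (by
      intro i hi
      exact hgood i (Finset.mem_filter.mp hi).2)
  have hB : (2 : ℤ) ^ (2 * m) ∣ ∏ i ∈ S, X i - ∏ i ∈ S, Y i := by
    rcases S.eq_empty_or_nonempty with h0 | ⟨a, ha⟩
    · rw [h0]; simp
    · have hSbad : ∀ i ∈ S, Odd ((i + 1) * k i) := fun i hi => (Finset.mem_filter.mp hi).2
      rw [← Finset.mul_prod_erase _ _ ha, ← Finset.mul_prod_erase _ _ ha]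
      have h1 := dvd_prod_sub ((2 : ℤ) ^ (2 * m - 1)) (S.erase a) X Y (by
        intro i hi
        exact (hbad i (hSbad i (Finset.mem_of_mem_erase hi))).1)
      obtain ⟨h2, h3, h4⟩ := hbad a (hSbad a ha)
      have hne : (S.erase a).Nonempty := by
        rw [← Finset.card_pos, Finset.card_erase_of_mem ha]
        have : 0 < S.card := Finset.card_pos.mpr ⟨a, ha⟩
        have h1 : S.card ≠ 1 := fun h => hSc (h ▸ odd_one)
        omega
      obtain ⟨c, hc⟩ := hne
      have h5 : (2 : ℤ) ∣ ∏ i ∈ S.erase a, Y i :=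
        (hbad c (hSbad c (Finset.mem_of_mem_erase hc))).2.2.trans (Finset.dvd_prod_of_mem _ hc)
      have h6 := dvd_add (mul_dvd_mul h3 h1) (mul_dvd_mul h5 h2)
      rw [← pow_succ', show 2 * m - 1 + 1 = 2 * m by omega] at h6
      refine h6.trans (dvd_of_eq ?_)
      ring
  have h7 := dvd_add (hB.mul_right (∏ i ∈ (Finset.range n).filter (fun i => ¬ Odd ((i + 1) * k i)), X i))
    (hA.mul_left (∏ i ∈ S, Y i))
  refine h7.trans (dvd_of_eq ?_)
  ring

theorem main_prod (p n : ℕ) (hp : p.Prime) (B : ℕ → ℤ) (k : ℕ → ℕ) (E m : ℕ) (hm : 1 ≤ m)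
    (hE : p ^ m ∣ p * E) (hsum : ∑ i ∈ Finset.range n, (i + 1) * k i = E) :
    (p : ℤ) ^ (2 * m) ∣
      (-1) ^ (p * E) * ((-1) ^ (p * ∑ i ∈ Finset.range n, k i) *
        ∏ i ∈ Finset.range n, zbinom (((i : ℤ) + 1) * B i * ((p * E : ℕ) : ℤ)) (p * k i))
      - (-1) ^ E * ((-1) ^ (∑ i ∈ Finset.range n, k i) *
        ∏ i ∈ Finset.range n, zbinom (((i : ℤ) + 1) * B i * (E : ℤ)) (k i)) := by
  have h0 : ∀ i : ℕ, ((i : ℤ) + 1) * B i * ((p * E : ℕ) : ℤ)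
      = p * (((i : ℤ) + 1) * B i * (E : ℤ)) := by
    intro i; push_cast; ring
  simp only [h0]
  by_cases hp2 : p = 2
  · subst hp2
    rw [pow_mul (-1 : ℤ) 2 E, pow_mul (-1 : ℤ) 2 (∑ i ∈ Finset.range n, k i)]
    simp only [even_two, Even.neg_pow, one_pow, one_mul]
    rcases Nat.lt_or_ge m 2 with h1 | h1
    · obtain rfl : m = 1 := by omega
      have h2 : (-1 : ℤ) ^ E * ((-1) ^ (∑ i ∈ Finset.range n, k i) *
          ∏ i ∈ Finset.range n, zbinom (((i : ℤ) + 1) * B i * (E : ℤ)) (k i))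
          = ∏ i ∈ Finset.range n, ((-1) ^ ((i + 1) * k i + k i) *
            zbinom (((i : ℤ) + 1) * B i * (E : ℤ)) (k i)) := by
        rw [Finset.prod_mul_distrib, Finset.prod_pow_eq_pow_sum, Finset.sum_add_distrib, hsum,
          pow_add]
        ring
      rw [h2]
      apply dvd_prod_sub
      intro i _
      have h3 := zb_four (k i) (((i : ℤ) + 1) * B i * (E : ℤ))
      push_cast
      rcases Nat.even_or_odd ((i + 1) * k i + k i) with h4 | h4
      · rw [h4.neg_one_pow, one_mul]; exact h3
      · have h4' := h4
        rw [show (i + 1) * k i + k i = (i + 2) * k i by ring] at h4'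
        obtain ⟨h5, h6⟩ := Nat.odd_mul.mp h4'
        have h7 := zb_odd_dvd (k i) 1 h6 (((i : ℤ) + 1) * B i * (E : ℤ)) (by
          rw [pow_one]
          refine Dvd.dvd.mul_right (Dvd.dvd.mul_right ?_ _) _
          obtain ⟨r, hr⟩ := h5
          exact ⟨r, by push_cast [← Nat.cast_inj (R := ℤ)] at hr; linarith⟩)
        rw [h4.neg_one_pow]
        omega
    · have hE' : 2 ^ (m - 1) ∣ E := by
        rw [show m = (m - 1) + 1 by omega, pow_succ, mul_comm] at hE
        exact Nat.dvd_of_mul_dvd_mul_left two_pos hE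
      have hEeven : Even E := by
        rw [even_iff_two_dvd]
        exact (dvd_pow_self 2 (by omega)).trans hE'
      have := main_prod_two n (fun i : ℕ => ((i : ℤ) + 1) * B i * (E : ℤ)) k E m h1 hE'
        (fun i => ⟨B i, by ring⟩) hsum
      rw [Finset.prod_mul_distrib, Finset.prod_pow_eq_pow_sum] at this
      rw [hEeven.neg_one_pow, one_mul]
      exact_mod_cast this
  · have hodd := hp.odd_of_ne_two hp2
    rw [pow_mul (-1 : ℤ) p E, pow_mul (-1 : ℤ) p (∑ i ∈ Finset.range n, k i), hodd.neg_one_pow, ← mul_sub, ← mul_sub]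
    refine Dvd.dvd.mul_left (Dvd.dvd.mul_left ?_ _) _
    apply dvd_prod_sub
    intro i _
    apply zb_good p (k i) m hp (Or.inl hp2)
    have : (p : ℤ) ^ m ∣ p * E := by exact_mod_cast hE
    exact this.trans ⟨((i : ℤ) + 1) * B i, by ring⟩

theorem mem_part (e : ℕ) (l : ℕ → ℕ) : l ∈ partitionFinset e ↔
    Antitone l ∧ ∑ i ∈ Finset.range (e + 2), l i = e ∧ ∀ i, e + 2 ≤ i → l i = 0 := by
  classical
  unfold partitionFinset
  simp only [Finset.mem_image, Finset.mem_filter, Finset.mem_univ, true_and]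
  constructor
  · rintro ⟨f, ⟨hf, hs⟩, rfl⟩
    refine ⟨?_, ?_, ?_⟩
    · intro i j hij
      dsimp only
      split_ifs with h1 h2
      · exact hf ⟨i, h2⟩ ⟨j, h1⟩ hij
      · omega
      · exact Nat.zero_le _
      · exact le_rfl
    · rw [Finset.sum_range]
      simpa using hs
    · intro i hi
      simp [show ¬ i < e + 2 by omega]
  · rintro ⟨ha, hs, hz⟩
    have hle : ∀ i, i < e + 2 → l i < e + 1 := by
      intro i hi
      have := Finset.single_le_sum (f := l) (fun _ _ => Nat.zero_le _) (Finset.mem_range.mpr hi)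
      omega
    refine ⟨fun i => ⟨l i, hle i i.2⟩, ⟨?_, ?_⟩, ?_⟩
    · intro i j hij
      exact ha hij
    · rw [Finset.sum_range] at hs
      simpa using hs
    · funext n
      split_ifs with h
      · rfl
      · exact (hz n (by omega)).symm

theorem part_vanish {e : ℕ} {l : ℕ → ℕ} (h : l ∈ partitionFinset e) (i : ℕ) (hi : e ≤ i) :
    l i = 0 := by
  obtain ⟨ha, hs, hz⟩ := (mem_part e l).mp h
  have h1 : l e = 0 := by
    have h2 : ∑ j ∈ Finset.range (e + 1), l e ≤ ∑ j ∈ Finset.range (e + 1), l j := by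
      refine Finset.sum_le_sum fun j hj => ha ?_
      have := Finset.mem_range.mp hj
      omega
    rw [Finset.sum_range_succ] at hs
    simp only [Finset.sum_const, Finset.card_range, smul_eq_mul] at h2
    by_contra h3
    have : 1 ≤ l e := by omega
    have : (e + 1) * 1 ≤ (e + 1) * l e := Nat.mul_le_mul_left _ this
    omega
  have := ha hi
  omega

theorem part_sum {e : ℕ} {l : ℕ → ℕ} (h : l ∈ partitionFinset e) (n : ℕ) (hn : e ≤ n) :
    ∑ i ∈ Finset.range n, l i = e := by
  have key : ∀ n, e ≤ n → ∑ i ∈ Finset.range e, l i = ∑ i ∈ Finset.range n, l i := by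
    intro n hn
    refine Finset.sum_subset (Finset.range_mono hn) fun i _ hi => ?_
    exact part_vanish h i (by simpa using hi)
  rw [← key n hn, key (e + 2) (by omega)]
  exact ((mem_part e l).mp h).2.1

theorem tele1 {l : ℕ → ℕ} (ha : Antitone l) (n : ℕ) :
    ∑ i ∈ Finset.range n, (l i - l (i + 1)) + l n = l 0 := by
  induction n with
  | zero => simp
  | succ n ih =>
    rw [Finset.sum_range_succ]
    have := ha (Nat.le_succ n)
    simp only [Nat.succ_eq_add_one] at this
    omega

theorem tele2 {l : ℕ → ℕ} (ha : Antitone l) (n : ℕ) :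
    ∑ i ∈ Finset.range n, (i + 1) * (l i - l (i + 1)) + n * l n = ∑ i ∈ Finset.range n, l i := by
  induction n with
  | zero => simp
  | succ n ih =>
    rw [Finset.sum_range_succ, Finset.sum_range_succ, ← ih]
    obtain ⟨c, hc⟩ := Nat.exists_eq_add_of_le (ha (Nat.le_succ n))
    simp only [Nat.succ_eq_add_one] at hc
    rw [hc, Nat.add_sub_cancel_left]
    ring

theorem part_tele1 {e : ℕ} {l : ℕ → ℕ} (h : l ∈ partitionFinset e) (n : ℕ) (hn : e ≤ n) :
    ∑ i ∈ Finset.range n, (l i - l (i + 1)) = l 0 := by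
  have := tele1 ((mem_part e l).mp h).1 n
  rw [part_vanish h n hn] at this
  simpa using this

theorem part_tele2 {e : ℕ} {l : ℕ → ℕ} (h : l ∈ partitionFinset e) (n : ℕ) (hn : e ≤ n) :
    ∑ i ∈ Finset.range n, (i + 1) * (l i - l (i + 1)) = e := by
  have := tele2 ((mem_part e l).mp h).1 n
  rw [part_vanish h n hn, part_sum h n hn] at this
  simpa using this

theorem part_prod {e : ℕ} {l : ℕ → ℕ} (h : l ∈ partitionFinset e) (n : ℕ) (hn : e ≤ n)
    (a : ℕ → ℤ) : ∏ i ∈ Finset.range (e + 1), zbinom (a i) (l i - l (i + 1))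
      = ∏ i ∈ Finset.range (n + 1), zbinom (a i) (l i - l (i + 1)) := by
  refine Finset.prod_subset (Finset.range_mono (by omega)) fun i _ hi => ?_
  have : e + 1 ≤ i := by simpa using hi
  rw [part_vanish h i (by omega), Nat.zero_sub, zb_zero]

theorem part_scale (p E : ℕ) (hp : 0 < p) (l : ℕ → ℕ) (h : l ∈ partitionFinset E) :
    (fun i => p * l i) ∈ partitionFinset (p * E) := by
  rw [mem_part]
  have hE : E ≤ p * E := Nat.le_mul_of_pos_left _ hp
  refine ⟨fun i j hij => Nat.mul_le_mul_left _ (((mem_part E l).mp h).1 hij), ?_, ?_⟩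
  · rw [← Finset.mul_sum, part_sum h _ (by omega)]
  · intro i hi
    rw [part_vanish h i (by omega), mul_zero]

theorem part_unscale (p E : ℕ) (hp : 0 < p) (l : ℕ → ℕ)
    (h : (fun i => p * l i) ∈ partitionFinset (p * E)) : l ∈ partitionFinset E := by
  have ha : Antitone l := fun i j hij =>
    Nat.le_of_mul_le_mul_left (((mem_part _ _).mp h).1 hij) hp
  have hE : E ≤ p * E := Nat.le_mul_of_pos_left _ hp
  have hs := part_sum h (p * E + 2) (by omega)
  rw [← Finset.mul_sum] at hs
  have hs := Nat.eq_of_mul_eq_mul_left hp hs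
  have hE1 : l (E + 1) = 0 := by
    by_contra h3
    have h2 : ∑ j ∈ Finset.range (E + 2), 1 ≤ ∑ j ∈ Finset.range (E + 2), l j := by
      refine Finset.sum_le_sum fun j hj => ?_
      have := Finset.mem_range.mp hj
      have := ha (show j ≤ E + 1 by omega)
      omega
    have h4 : ∑ j ∈ Finset.range (E + 2), l j ≤ ∑ j ∈ Finset.range (p * E + 2), l j :=
      Finset.sum_le_sum_of_subset (Finset.range_mono (by omega))
    simp at h2
    omega
  have hz : ∀ i, E + 2 ≤ i → l i = 0 := by
    intro i hi
    have := ha (show E + 1 ≤ i by omega)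
    omega
  rw [mem_part]
  refine ⟨ha, ?_, hz⟩
  refine (Finset.sum_subset (Finset.range_mono (by omega)) fun i _ hi => ?_).trans hs
  exact hz i (by simpa using hi)

theorem part_dvd {e : ℕ} {l : ℕ → ℕ} (h : l ∈ partitionFinset e) (p : ℕ)
    (hk : ∀ i ∈ Finset.range (e + 1), p ∣ l i - l (i + 1)) (i : ℕ) : p ∣ l i := by
  have ha := ((mem_part e l).mp h).1
  rcases Nat.lt_or_ge (e + 1) i with hi | hi
  · rw [part_vanish h i (by omega)]; exact dvd_zero _
  · refine Nat.decreasingInduction (motive := fun i _ => p ∣ l i) (n := e + 1) ?_ ?_ hi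
    · intro i hi ih
      have h1 := hk i (Finset.mem_range.mpr hi)
      exact (Nat.dvd_sub_iff_left (ha (Nat.le_succ i)) ih).mp h1
    · rw [part_vanish h _ (by omega)]; exact dvd_zero _

theorem partSum_cong (b : ℕ → ℤ) (p E m : ℕ) (hp : p.Prime) (hm : 1 ≤ m) (hE : p ^ m ∣ p * E) :
    (p : ℤ) ^ (2 * m) ∣
      (-1) ^ (p * E) * partSum b (p * E) - (-1) ^ E * partSum b E := by
  classical
  have hEle : E ≤ p * E := Nat.le_mul_of_pos_left _ hp.pos
  set T : (ℕ → ℕ) → ℤ := fun l => (-1) ^ (l 0) *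
    ∏ i ∈ Finset.range (p * E + 1),
      zbinom (((i : ℤ) + 1) * b (i + 1) * ((p * E : ℕ) : ℤ)) (l i - l (i + 1)) with hT
  have h1 : partSum b (p * E) = ∑ l ∈ partitionFinset (p * E), T l := rfl
  have h2 : partSum b E = ∑ l ∈ partitionFinset E, ((-1) ^ (l 0) *
    ∏ i ∈ Finset.range (p * E + 1),
      zbinom (((i : ℤ) + 1) * b (i + 1) * (E : ℤ)) (l i - l (i + 1))) := by
    unfold partSum
    refine Finset.sum_congr rfl fun l hl => ?_
    rw [part_prod hl (p * E) hEle]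
  rw [h1, ← Finset.sum_filter_add_sum_filter_not _ (fun l => ∀ i, p ∣ l i)]
  have h3 : ∑ l ∈ (partitionFinset (p * E)).filter (fun l => ∀ i, p ∣ l i), T l
      = ∑ l ∈ partitionFinset E, T (fun i => p * l i) := by
    symm
    refine Finset.sum_nbij (fun l i => p * l i) ?_ ?_ ?_ ?_
    · intro l hl
      exact Finset.mem_filter.mpr ⟨part_scale p E hp.pos l hl, fun i => dvd_mul_right _ _⟩
    · intro l _ l' _ hll
      funext i
      exact Nat.eq_of_mul_eq_mul_left hp.pos (congrFun hll i)
    · intro l hl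
      obtain ⟨hl1, hl2⟩ := Finset.mem_filter.mp hl
      choose f hf using hl2
      obtain rfl : l = fun i => p * f i := funext hf
      exact ⟨f, part_unscale p E hp.pos f hl1, rfl⟩
    · intro l _
      rfl
  have h4 : (p : ℤ) ^ (2 * m) ∣
      ∑ l ∈ (partitionFinset (p * E)).filter (fun l => ¬ ∀ i, p ∣ l i), T l := by
    refine Finset.dvd_sum fun l hl => ?_
    obtain ⟨hl1, hl2⟩ := Finset.mem_filter.mp hl
    refine Dvd.dvd.mul_left ?_ _
    refine nondiv p m (p * E + 1) hp (fun i => b (i + 1)) (fun i => l i - l (i + 1)) (p * E) hE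
      (part_tele2 hl1 _ (by omega)) ?_
    by_contra! hcon
    exact hl2 (part_dvd hl1 p hcon)
  have h5 : (p : ℤ) ^ (2 * m) ∣ (-1) ^ (p * E) * ∑ l ∈ partitionFinset E, T (fun i => p * l i)
      - (-1) ^ E * partSum b E := by
    rw [h2, Finset.mul_sum, Finset.mul_sum, ← Finset.sum_sub_distrib]
    refine Finset.dvd_sum fun l hl => ?_
    have := main_prod p (p * E + 1) hp (fun i => b (i + 1)) (fun i => l i - l (i + 1)) E m hm hE
      (part_tele2 hl _ (by omega))
    rw [part_tele1 hl _ (by omega)] at this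
    simp only [hT, ← Nat.mul_sub]
    exact this
  rw [h3]
  refine (dvd_add h5 (h4.mul_left ((-1) ^ (p * E)))).trans (dvd_of_eq ?_)
  ring

/-- (Proof of Theorem `duality`: the splitting (14) and its consequence.)  Fix integers
`∑_{e∣d, v_p(e)=m} μ(d/e)(-1)^e partSum(e) − ∑_{e∣d, v_p(e)=m} μ(d/e)(-1)^{e/p} partSum(e/p)`
is divisible by `p^{2m}`, and consequently the full sum
`d²·a_d = ∑_{e∣d} μ(d/e)(-1)^e partSum(e)` is divisible by `p^{2m}`,
i.e. `a_d ∈ ℤ_{(p)}`. -/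
theorem duality_splitting (b : ℕ → ℤ) (d p m : ℕ) (hp : p.Prime) (hm : 1 ≤ m)
    (hdvd : p ^ m ∣ d) (hndvd : ¬ p ^ (m + 1) ∣ d) :
    ((p : ℤ) ^ (2 * m) ∣
        (∑ e ∈ d.divisors.filter fun e => padicValNat p e = m,
            (ArithmeticFunction.moebius (d / e) : ℤ) * (-1) ^ e * partSum b e)
          - ∑ e ∈ d.divisors.filter fun e => padicValNat p e = m,
              (ArithmeticFunction.moebius (d / e) : ℤ) * (-1) ^ (e / p) * partSum b (e / p))
      ∧ (p : ℤ) ^ (2 * m) ∣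
          ∑ e ∈ d.divisors,
            (ArithmeticFunction.moebius (d / e) : ℤ) * (-1) ^ e * partSum b e := by
  have hd0 : d ≠ 0 := by
    rintro rfl
    exact hndvd (dvd_zero _)
  have : Fact p.Prime := ⟨hp⟩
  have hA : (p : ℤ) ^ (2 * m) ∣
        (∑ e ∈ d.divisors.filter fun e => padicValNat p e = m,
            (ArithmeticFunction.moebius (d / e) : ℤ) * (-1) ^ e * partSum b e)
          - ∑ e ∈ d.divisors.filter fun e => padicValNat p e = m,
              (ArithmeticFunction.moebius (d / e) : ℤ) * (-1) ^ (e / p) * partSum b (e / p) := by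
    rw [← Finset.sum_sub_distrib]
    refine Finset.dvd_sum fun e he => ?_
    obtain ⟨he1, he2⟩ := Finset.mem_filter.mp he
    have hpe : p ^ m ∣ e := he2 ▸ pow_padicValNat_dvd
    obtain ⟨E, rfl⟩ := (dvd_pow_self p (by omega)).trans hpe
    rw [Nat.mul_div_cancel_left _ hp.pos]
    refine ((partSum_cong b p E m hp hm hpe).mul_left
      (ArithmeticFunction.moebius (d / (p * E)))).trans (dvd_of_eq ?_)
    ring
  refine ⟨hA, ?_⟩
  have hvd : padicValNat p d = m := by
    have h1 := (padicValNat_dvd_iff_le hd0).mp hdvd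
    have h2 : ¬ (m + 1 ≤ padicValNat p d) := fun h => hndvd ((padicValNat_dvd_iff_le hd0).mpr h)
    omega
  refine hA.trans (dvd_of_eq ?_)
  rw [← Finset.sum_filter_add_sum_filter_not d.divisors (fun e => padicValNat p e = m)
    (fun e => (ArithmeticFunction.moebius (d / e) : ℤ) * (-1) ^ e * partSum b e), sub_eq_add_neg]
  congr 1
  rw [← Finset.sum_neg_distrib]
  refine Finset.sum_of_injOn (fun e => e / p) ?_ ?_ ?_ ?_
  · intro e he e' he' hee
    simp only [Finset.coe_filter, Set.mem_ofPred_eq] at he he'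
    have h1 : p ∣ e := (dvd_pow_self p (by omega)).trans (he.2 ▸ pow_padicValNat_dvd : p ^ m ∣ e)
    have h2 : p ∣ e' := (dvd_pow_self p (by omega)).trans (he'.2 ▸ pow_padicValNat_dvd : p ^ m ∣ e')
    exact (Nat.div_left_inj h1 h2).mp hee
  · intro e he
    simp only [Finset.coe_filter, Set.mem_ofPred_eq, Nat.mem_divisors] at he ⊢
    have h1 : p ∣ e := (dvd_pow_self p (by omega)).trans (he.2 ▸ pow_padicValNat_dvd : p ^ m ∣ e)
    refine ⟨⟨(Nat.div_dvd_of_dvd h1).trans he.1.1, hd0⟩, ?_⟩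
    rw [padicValNat.div h1]
    omega
  · intro e he hne
    simp only [Finset.mem_filter, Nat.mem_divisors] at he
    obtain ⟨⟨⟨c, hc⟩, -⟩, hv⟩ := he
    have he0 : e ≠ 0 := by rintro rfl; simp at hc; exact hd0 hc
    have hc0 : c ≠ 0 := by rintro rfl; simp at hc; exact hd0 hc
    have hdiv : d / e = c := by rw [hc, Nat.mul_div_cancel_left _ (Nat.pos_of_ne_zero he0)]
    rw [hdiv]
    have hsum : padicValNat p e + padicValNat p c = m := by
      rw [← padicValNat.mul he0 hc0, ← hc, hvd]
    by_cases hsq : Squarefree c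
    · exfalso
      have h1 : padicValNat p c ≤ 1 := by
        by_contra hcon
        have : p * p ∣ c := by
          rw [← pow_two]
          exact (padicValNat_dvd_iff_le hc0).mpr (by omega)
        exact hp.one_lt.ne' (Nat.isUnit_iff.mp (hsq p this))
      apply hne
      have hpc : p ∣ c := dvd_of_one_le_padicValNat (by omega)
      refine ⟨p * e, ?_, ?_⟩
      · simp only [Finset.coe_filter, Set.mem_ofPred_eq, Nat.mem_divisors]
        refine ⟨⟨?_, hd0⟩, ?_⟩
        · rw [hc, mul_comm p e]
          exact Nat.mul_dvd_mul_left e hpc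
        · rw [padicValNat.mul hp.ne_zero he0, padicValNat.self hp.one_lt]
          omega
      · exact Nat.mul_div_cancel_left _ hp.pos
    · rw [ArithmeticFunction.moebius_eq_zero_of_not_squarefree hsq]
      simp
  · intro e he
    obtain ⟨he1, he2⟩ := Finset.mem_filter.mp he
    have h1 : p ∣ e := (dvd_pow_self p (by omega)).trans (he2 ▸ pow_padicValNat_dvd : p ^ m ∣ e)
    obtain ⟨E, rfl⟩ := h1
    obtain ⟨⟨c, hc⟩, -⟩ := Nat.mem_divisors.mp he1
    have hE0 : E ≠ 0 := by rintro rfl; simp at hc; exact hd0 hc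
    have hc0 : c ≠ 0 := by rintro rfl; simp at hc; exact hd0 hc
    have hpE0 : p * E ≠ 0 := mul_ne_zero hp.ne_zero hE0
    rw [Nat.mul_div_cancel_left _ hp.pos]
    have h2 : d / (p * E) = c := by
      rw [hc, Nat.mul_div_cancel_left _ (Nat.pos_of_ne_zero hpE0)]
    have h3 : d / E = p * c := by
      rw [hc, mul_comm p E, mul_assoc, Nat.mul_div_cancel_left _ (Nat.pos_of_ne_zero hE0)]
    have hpc : ¬ p ∣ c := by
      intro h
      have h4 : 1 ≤ padicValNat p c := one_le_padicValNat_of_dvd hc0 h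
      have h5 : padicValNat p (p * E) + padicValNat p c = m := by
        rw [← padicValNat.mul hpE0 hc0, ← hc, hvd]
      omega
    rw [h2, h3, ArithmeticFunction.isMultiplicative_moebius.map_mul_of_coprime
      ((Nat.Prime.coprime_iff_not_dvd hp).mpr hpc), ArithmeticFunction.moebius_apply_prime hp]
    ring
end
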